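/- Let (X,d,μ) be an Ahlfors regular space of dimension Q, i.e., C₁ r^Q ≤ μ(B(x,r)) ≤ C₂ r^Q for all x ∈ X and r > 0. Given 0 < α < Q, let p(·): X → [1,∞) satisfy p(·) ∈ LH and 1 < p₋ ≤ p₊ < Q/α, and define q(·) by 1/p(·) − 1/q(·) = α/Q. Then there exists C such that for all f ∈ L^{p(·)}(X): ‖I*_α f‖_{L^{q(·)}(X)} ≤ C ‖f‖_{L^{p(·)}(X)}, where I*_α f(x) = ∫_X f(y)/d(x,y)^{Q−α} dμ(y). -/

import Mathlib

open MeasureTheory ENNReal Filter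

/-- Quasi-metric ball. -/
def qball {X : Type*} (d : X → X → ℝ) (x : X) (r : ℝ) : Set X := {y | d x y < r}

/-- `(X,d)` is a quasi-metric space with quasi-metric constant `A₀`. -/
def IsQuasiMetric {X : Type*} (d : X → X → ℝ) (A₀ : ℝ) : Prop :=
  1 ≤ A₀ ∧ (∀ x y, 0 ≤ d x y) ∧ (∀ x y, d x y = 0 ↔ x = y) ∧ (∀ x y, d x y = d y x) ∧
    ∀ x y z, d x y ≤ A₀ * (d x z + d y z)

/-- `μ` is doubling with doubling constant `Cμ` for quasi-metric balls. -/
def IsDoubling {X : Type*} [MeasurableSpace X] (d : X → X → ℝ) (μ : MeasureTheory.Measure X)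
    (Cμ : ℝ) : Prop :=
  1 ≤ Cμ ∧ ∀ x r, 0 < r → μ (qball d x (2 * r)) ≤ ENNReal.ofReal Cμ * μ (qball d x r)

/-- All quasi-metric balls have positive finite measure. -/
def BallsFinite {X : Type*} [MeasurableSpace X] (d : X → X → ℝ)
    (μ : MeasureTheory.Measure X) : Prop :=
  ∀ x r, 0 < r → 0 < μ (qball d x r) ∧ μ (qball d x r) < ⊤

/-- Reverse doubling: `μ(B(x,r/2)) ≤ γ μ(B(x,r))` whenever `B(x,r) ⊊ X`. -/
def IsReverseDoubling {X : Type*} [MeasurableSpace X] (d : X → X → ℝ)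
    (μ : MeasureTheory.Measure X) (γ : ℝ) : Prop :=
  0 < γ ∧ γ < 1 ∧ ∀ x r, 0 < r → qball d x r ≠ Set.univ →
    μ (qball d x (r / 2)) ≤ ENNReal.ofReal γ * μ (qball d x r)

/-- The fractional maximal operator `M_η`. -/
noncomputable def fracMax {X : Type*} [MeasurableSpace X] (d : X → X → ℝ)
    (μ : MeasureTheory.Measure X) (η : ℝ) (f : X → ℝ) (x : X) : ℝ≥0∞ :=
  ⨆ (z : X) (r : ℝ) (_ : 0 < r) (_ : x ∈ qball d z r),
    μ (qball d z r) ^ η * ((μ (qball d z r))⁻¹ * ∫⁻ y in qball d z r, ENNReal.ofReal |f y| ∂μ)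

/-- A dyadic grid on a space of homogeneous type (Hytönen–Kairema). -/
def IsDyadicGrid {X : Type*} [MeasurableSpace X] (d : X → X → ℝ)
    (μ : MeasureTheory.Measure X) (𝒟 : ℤ → Set (Set X)) : Prop :=
  ∃ (C δ ε : ℝ) (xc : Set X → X), 0 < C ∧ 0 < δ ∧ δ < 1 ∧ 0 < ε ∧ ε < 1 ∧
    (∀ k, (𝒟 k).PairwiseDisjoint id ∧ ⋃₀ 𝒟 k = Set.univ) ∧
    (∀ k l, ∀ Q₁ ∈ 𝒟 k, ∀ Q₂ ∈ 𝒟 l, Q₁ ∩ Q₂ = ∅ ∨ Q₁ ⊆ Q₂ ∨ Q₂ ⊆ Q₁) ∧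
    (∀ k, ∀ Q₁ ∈ 𝒟 k, ∃ Q₂ ∈ 𝒟 (k + 1), Q₂ ⊆ Q₁) ∧
    (∀ k, ∀ Q₁ ∈ 𝒟 k, ∃! Q₃, Q₃ ∈ 𝒟 (k - 1) ∧ Q₁ ⊆ Q₃) ∧
    (∀ k, ∀ Q₁ ∈ 𝒟 k, ∀ Q₂ ∈ 𝒟 (k + 1), Q₂ ⊆ Q₁ → ENNReal.ofReal ε * μ Q₁ ≤ μ Q₂) ∧
    (∀ k, ∀ Q ∈ 𝒟 k, MeasurableSet Q ∧
      qball d (xc Q) (δ ^ k) ⊆ Q ∧ Q ⊆ qball d (xc Q) (C * δ ^ k))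

/-- The dyadic fractional maximal operator `M^𝒟_η`. -/
noncomputable def dyadicFracMax {X : Type*} [MeasurableSpace X]
    (μ : MeasureTheory.Measure X) (𝒟 : ℤ → Set (Set X)) (η : ℝ) (f : X → ℝ) (x : X) : ℝ≥0∞ :=
  ⨆ (k : ℤ) (Q ∈ 𝒟 k) (_ : x ∈ Q),
    μ Q ^ η * ((μ Q)⁻¹ * ∫⁻ y in Q, ENNReal.ofReal |f y| ∂μ)

/-- Local log-Hölder continuity with constant `C₀`. -/
def LH0 {X : Type*} (d : X → X → ℝ) (r : X → ℝ) (C₀ : ℝ) : Prop :=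
  ∀ x y, d x y < 1 / 2 → |r x - r y| ≤ -C₀ / Real.log (d x y)

/-- Log-Hölder continuity at infinity with base point `x₀`, constant `Cinf`, limit `rinf`. -/
def LHinf {X : Type*} (d : X → X → ℝ) (r : X → ℝ) (x₀ : X) (Cinf rinf : ℝ) : Prop :=
  ∀ x, |r x - rinf| ≤ Cinf / Real.log (Real.exp 1 + d x x₀)

/-- The modular of the variable Lebesgue space `L^{p(·)}`. -/
noncomputable def vModular {X : Type*} [MeasurableSpace X] (μ : MeasureTheory.Measure X)
    (p : X → ℝ≥0∞) (g : X → ℝ≥0∞) (lam : ℝ≥0∞) : ℝ≥0∞ :=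
  (∫⁻ x in {x | p x ≠ ⊤}, (g x / lam) ^ (p x).toReal ∂μ)
    + lam⁻¹ * essSup g (μ.restrict {x | p x = ⊤})

/-- The Luxemburg norm of the variable Lebesgue space `L^{p(·)}`. -/
noncomputable def vNorm {X : Type*} [MeasurableSpace X] (μ : MeasureTheory.Measure X)
    (p : X → ℝ≥0∞) (g : X → ℝ≥0∞) : ℝ≥0∞ :=
  sInf {lam : ℝ≥0∞ | 0 < lam ∧ vModular μ p g lam ≤ 1}

/-- The fractional integral operator (Riesz potential) `I_η`, applied to `|f|`. -/
noncomputable def fracInt {X : Type*} [MeasurableSpace X] (d : X → X → ℝ)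
    (μ : MeasureTheory.Measure X) (η : ℝ) (f : X → ℝ) (x : X) : ℝ≥0∞ :=
  ∫⁻ y, ENNReal.ofReal |f y| / μ (qball d x (d x y)) ^ (1 - η) ∂μ

/-- The fractional integral operator `I*_α` on variable Lebesgue spaces. -/
noncomputable def fracIntStar {X : Type*} [MeasurableSpace X] (d : X → X → ℝ)
    (μ : MeasureTheory.Measure X) (Qdim α : ℝ) (f : X → ℝ) (x : X) : ℝ≥0∞ :=
  ∫⁻ y, ENNReal.ofReal |f y| / ENNReal.ofReal (d x y ^ (Qdim - α)) ∂μ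


namespace S19

lemma two_pow_cond (δ : ℝ) (hδ : 0 < δ) (k : ℤ) :
    (2:ℝ) ^ (k:ℝ) ≤ δ ↔ k ≤ ⌊Real.logb 2 δ⌋ := by
  rw [Int.le_floor, Real.le_logb_iff_rpow_le (by norm_num) hδ]

lemma geo_sum {c : ℝ} (hc : 0 < c) : ∃ K : ℝ, 0 < K ∧ ∀ c' ≥ c, ∀ δ : ℝ, 0 < δ →
    ∑' k : ℤ, (if (2:ℝ) ^ (k:ℝ) ≤ δ then ENNReal.ofReal ((2:ℝ) ^ ((k:ℝ) * c')) else 0)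
      ≤ ENNReal.ofReal (K * δ ^ c') := by
  have hb0 : (0:ℝ) < 2 ^ (-c) := by positivity
  have hb1 : (2:ℝ) ^ (-c) < 1 := Real.rpow_lt_one_of_one_lt_of_neg (by norm_num) (by linarith)
  refine ⟨(1 - 2 ^ (-c))⁻¹, inv_pos.2 (by linarith), ?_⟩
  intro c' hc' δ hδ
  set k0 := ⌊Real.logb 2 δ⌋ with hk0
  have hk0δ : (2:ℝ) ^ (k0:ℝ) ≤ δ := (two_pow_cond δ hδ k0).2 le_rfl
  rw [← (Equiv.subLeft k0).tsum_eq]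
  have hinj : Function.Injective (fun n : ℕ => (n : ℤ)) := Nat.cast_injective
  rw [← hinj.tsum_eq]
  · calc _ ≤ ∑' n : ℕ, ENNReal.ofReal (δ ^ c') * ENNReal.ofReal ((2 ^ (-c)) ^ n) := by
          apply ENNReal.tsum_le_tsum
          intro n
          split_ifs
          · rw [← ENNReal.ofReal_mul (by positivity)]
            apply ENNReal.ofReal_le_ofReal
            simp only [Equiv.subLeft_apply]
            push_cast
            rw [sub_mul, Real.rpow_sub (by norm_num), div_eq_mul_inv, ← Real.rpow_neg (by norm_num)]
            apply mul_le_mul _ _ (by positivity) (by positivity)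
            · rw [Real.rpow_mul (by norm_num)]
              exact Real.rpow_le_rpow (by positivity) hk0δ (by linarith)
            · rw [← Real.rpow_natCast, ← Real.rpow_mul (by norm_num)]
              apply Real.rpow_le_rpow_of_exponent_le (by norm_num)
              have : (0:ℝ) ≤ n := Nat.cast_nonneg n
              nlinarith
          · exact zero_le
      _ = _ := by
          rw [ENNReal.tsum_mul_left, mul_comm _ (δ ^ c'), ENNReal.ofReal_mul (by positivity)]
          congr 1
          rw [← ENNReal.ofReal_tsum_of_nonneg (fun n => by positivity)
            (summable_geometric_of_lt_one hb0.le hb1), tsum_geometric_of_lt_one hb0.le hb1]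
  · intro j hj
    simp only [Function.mem_support, ne_eq, ite_eq_right_iff, Classical.not_imp] at hj
    have h1 := (two_pow_cond δ hδ _).1 hj.1
    simp only [Equiv.subLeft_apply] at h1
    have : 0 ≤ j := by omega
    exact ⟨j.toNat, by simp [this]⟩

lemma geo_tail {c : ℝ} (hc : 0 < c) : ∃ K : ℝ, 0 < K ∧ ∀ c' ≥ c, ∀ δ : ℝ, 0 < δ →
    ∑' k : ℤ, (if δ ≤ (2:ℝ) ^ (k:ℝ) then ENNReal.ofReal ((2:ℝ) ^ (-((k:ℝ) * c'))) else 0)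
      ≤ ENNReal.ofReal (K * δ ^ (-c')) := by
  obtain ⟨K, hK, h⟩ := geo_sum hc
  refine ⟨K, hK, fun c' hc' δ hδ => ?_⟩
  have := h c' hc' δ⁻¹ (by positivity)
  rw [Real.inv_rpow hδ.le, ← Real.rpow_neg hδ.le] at this
  refine le_trans (le_of_eq ?_) this
  rw [← (Equiv.neg ℤ).tsum_eq]
  apply tsum_congr
  intro k
  simp only [Equiv.neg_apply, Int.cast_neg, neg_mul, neg_neg]
  congr 1
  rw [Real.rpow_neg (by norm_num)]
  rw [le_inv_comm₀ hδ (by positivity)]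

lemma dyadic_le {s : ℝ} (hs : 0 < s) (v : ℝ≥0∞) :
    v ≤ ∑' k : ℤ, (if ENNReal.ofReal ((2:ℝ) ^ ((k:ℝ) * s)) < v
      then ENNReal.ofReal ((2:ℝ) ^ (((k:ℝ) + 1) * s)) else 0) := by
  have key : ∀ a : ℝ, 0 < a → ENNReal.ofReal a ≤ v → ENNReal.ofReal a ≤
      ∑' k : ℤ, (if ENNReal.ofReal ((2:ℝ) ^ ((k:ℝ) * s)) < v
      then ENNReal.ofReal ((2:ℝ) ^ (((k:ℝ) + 1) * s)) else 0) := by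
    intro a ha hav
    set k : ℤ := ⌈Real.logb 2 a / s⌉ - 1
    have h1 : (k:ℝ) * s < Real.logb 2 a := by
      have := Int.ceil_lt_add_one (Real.logb 2 a / s)
      have h2 : (k:ℝ) < Real.logb 2 a / s := by simp only [k]; push_cast; linarith
      rwa [lt_div_iff₀ hs] at h2
    have h2 : Real.logb 2 a ≤ ((k:ℝ) + 1) * s := by
      have := Int.le_ceil (Real.logb 2 a / s)
      have h2 : Real.logb 2 a / s ≤ (k:ℝ) + 1 := by simp only [k]; push_cast; linarith
      rwa [div_le_iff₀ hs] at h2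
    rw [Real.lt_logb_iff_rpow_lt (by norm_num) ha] at h1
    rw [Real.logb_le_iff_le_rpow (by norm_num) ha] at h2
    refine le_trans ?_ (ENNReal.le_tsum k)
    rw [if_pos]
    · exact ENNReal.ofReal_le_ofReal h2
    · exact lt_of_lt_of_le ((ENNReal.ofReal_lt_ofReal_iff ha).2 h1) hav
  by_cases hv : v = ⊤
  · rw [hv] at key ⊢
    refine top_le_iff.2 (ENNReal.eq_top_of_forall_nnreal_le ?_)
    intro r
    refine le_trans ?_ (key (r + 1) (by positivity) le_top)
    rw [ENNReal.le_ofReal_iff_toReal_le (by simp) (by positivity)]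
    simp
  · by_cases h0 : v = 0
    · rw [h0]; exact zero_le
    have := key v.toReal (ENNReal.toReal_pos h0 hv) (by rw [ENNReal.ofReal_toReal hv])
    rwa [ENNReal.ofReal_toReal hv] at this

end S19

namespace S19

/-- Lower (inner) maximal function. -/
noncomputable def mAux {X : Type*} [MeasurableSpace X] (d : X → X → ℝ) (μ : Measure X)
    (Q : ℝ) (w : X → ℝ≥0∞) (x : X) : ℝ≥0∞ :=
  ⨆ (r : ℝ) (_ : 0 < r) (A : Set X) (_ : MeasurableSet A) (_ : A ⊆ qball d x r),
    (∫⁻ y in A, w y ∂μ) / ENNReal.ofReal (r ^ Q)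

lemma le_mAux {X : Type*} [MeasurableSpace X] (d : X → X → ℝ) (μ : Measure X)
    (Q : ℝ) (w : X → ℝ≥0∞) (x : X) {r : ℝ} (hr : 0 < r) {A : Set X} (hA : MeasurableSet A)
    (hAB : A ⊆ qball d x r) :
    (∫⁻ y in A, w y ∂μ) ≤ ENNReal.ofReal (r ^ Q) * mAux d μ Q w x := by
  have h : (∫⁻ y in A, w y ∂μ) / ENNReal.ofReal (r ^ Q) ≤ mAux d μ Q w x :=
    le_iSup_of_le r (le_iSup_of_le hr (le_iSup_of_le A (le_iSup_of_le hA
      (le_iSup_of_le hAB le_rfl))))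
  have hpos : 0 < r ^ Q := by positivity
  rw [ENNReal.div_le_iff (by simpa using hpos) (by simp)] at h
  rwa [mul_comm]

lemma weak_type {X : Type*} [MeasurableSpace X] {d : X → X → ℝ} {μ : Measure X} {A₀ : ℝ}
    (hqm : IsQuasiMetric d A₀) {C₂ Q : ℝ} (hC₂ : 0 < C₂) (hQ : 0 < Q)
    (hup : ∀ (x : X) (r : ℝ), 0 < r → μ (qball d x r) ≤ ENNReal.ofReal (C₂ * r ^ Q))
    (w : X → ℝ≥0∞) (t : ℝ) (ht : 0 < t) :
    μ {x | ENNReal.ofReal t < mAux d μ Q w x} ≤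
      ENNReal.ofReal (C₂ * (3 * A₀) ^ Q / t) * ∫⁻ y, w y ∂μ := by
  obtain ⟨hA₀, hd0, hdz, hsymm, htri⟩ := hqm
  set F := {x | ENNReal.ofReal t < mAux d μ Q w x} with hF
  have hcpos : 0 < C₂ * (3 * A₀) ^ Q / t := by
    have : 0 < A₀ := by linarith
    positivity
  by_cases hI : ∫⁻ y, w y ∂μ = ⊤
  · rw [hI, ENNReal.mul_top (by simpa using hcpos)]; exact le_top
  have hex : ∀ x, ∃ (r : ℝ) (A : Set X), x ∈ F → 0 < r ∧ MeasurableSet A ∧ A ⊆ qball d x r ∧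
      ENNReal.ofReal (t * r ^ Q) < ∫⁻ y in A, w y ∂μ := by
    intro x
    by_cases hx : x ∈ F
    · have hx' : ENNReal.ofReal t < mAux d μ Q w x := hx
      simp only [mAux, lt_iSup_iff] at hx'
      obtain ⟨r, hr, A, hA, hAB, h⟩ := hx'
      refine ⟨r, A, fun _ => ⟨hr, hA, hAB, ?_⟩⟩
      have hpos : 0 < r ^ Q := by positivity
      rw [ENNReal.lt_div_iff_mul_lt (by left; simpa using hpos) (by simp)] at h
      rwa [ENNReal.ofReal_mul ht.le]
    · exact ⟨0, ∅, fun h => absurd h hx⟩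
  choose r A hrA using hex
  obtain ⟨u, huF, hudisj, hucov⟩ := Vitali.exists_disjoint_subfamily_covering_enlargement
    (fun x => qball d x (r x)) F r 2 (by norm_num) (fun a ha => (hrA a ha).1.le)
    (((∫⁻ y, w y ∂μ).toReal / t) ^ Q⁻¹) (by
      intro a ha
      obtain ⟨h1, h2, h3, h4⟩ := hrA a ha
      rw [Real.le_rpow_inv_iff_of_pos h1.le (by positivity) hQ, le_div_iff₀ ht, mul_comm]
      rw [← ENNReal.ofReal_le_iff_le_toReal hI]
      exact h4.le.trans (setLIntegral_le_lintegral _ _))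
    (fun a ha => ⟨a, by
      have : d a a = 0 := (hdz a a).2 rfl
      simp only [qball, Set.mem_ofPred_eq, this]
      exact (hrA a ha).1⟩)
  have hsum : ∑' b : u, ∫⁻ y in A b, w y ∂μ ≤ ∫⁻ y, w y ∂μ := by
    have := tsum_meas_le_meas_iUnion_of_disjoint (μ.withDensity w) (As := fun b : u => A b)
      (fun b => (hrA b (huF b.2)).2.1) (by
        intro a b hab
        have := hudisj a.2 b.2 (fun h => hab (Subtype.ext h))
        exact Disjoint.mono (hrA a (huF a.2)).2.2.1 (hrA b (huF b.2)).2.2.1 this)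
    calc _ = ∑' b : u, (μ.withDensity w) (A b) := by
            apply tsum_congr
            intro b
            rw [withDensity_apply _ (hrA b (huF b.2)).2.1]
      _ ≤ _ := this
      _ ≤ (μ.withDensity w) Set.univ := measure_mono (Set.subset_univ _)
      _ = _ := by rw [withDensity_apply _ MeasurableSet.univ]; simp
  have hcount : u.Countable := by
    have h := Summable.countable_support_ennreal (ne_top_of_le_ne_top hI hsum)
    have huniv : Function.support (fun b : u => ∫⁻ y in A b, w y ∂μ) = Set.univ := by
      refine Set.eq_univ_iff_forall.2 fun b => ?_
      exact (lt_of_le_of_lt zero_le (hrA b (huF b.2)).2.2.2).ne'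
    rw [huniv] at h
    exact Set.countable_coe_iff.1 (Set.countable_univ_iff.1 h)
  have hcov : F ⊆ ⋃ b ∈ u, qball d b (3 * A₀ * r b) := by
    intro a ha
    obtain ⟨b, hb, ⟨y, hya, hyb⟩, hab⟩ := hucov a ha
    refine Set.mem_biUnion hb ?_
    simp only [qball, Set.mem_ofPred_eq] at hya hyb ⊢
    have := htri b a y
    nlinarith
  calc μ F ≤ μ (⋃ b ∈ u, qball d b (3 * A₀ * r b)) := measure_mono hcov
    _ ≤ ∑' b : u, μ (qball d b (3 * A₀ * r b)) := measure_biUnion_le μ hcount _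
    _ ≤ ∑' b : u, ENNReal.ofReal (C₂ * (3 * A₀) ^ Q / t) * ∫⁻ y in A b, w y ∂μ := by
        apply ENNReal.tsum_le_tsum
        intro b
        obtain ⟨h1, h2, h3, h4⟩ := hrA b (huF b.2)
        have hA0 : 0 < A₀ := by linarith
        refine (hup b _ (by positivity)).trans ?_
        refine le_trans (le_of_eq ?_) (mul_le_mul_right h4.le _)
        rw [← ENNReal.ofReal_mul hcpos.le]
        congr 1
        rw [Real.mul_rpow (by positivity) h1.le]
        field_simp
    _ = ENNReal.ofReal (C₂ * (3 * A₀) ^ Q / t) * ∑' b : u, ∫⁻ y in A b, w y ∂μ :=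
        ENNReal.tsum_mul_left
    _ ≤ _ := mul_le_mul_right hsum _

lemma mAux_trunc {X : Type*} [MeasurableSpace X] {d : X → X → ℝ} {μ : Measure X}
    {C₂ Q : ℝ} (hC₂ : 0 < C₂)
    (hup : ∀ (x : X) (r : ℝ), 0 < r → μ (qball d x r) ≤ ENNReal.ofReal (C₂ * r ^ Q))
    (w : X → ℝ≥0∞) (hw : Measurable w) (t : ℝ) (ht : 0 < t) (x : X) :
    mAux d μ Q w x ≤ ENNReal.ofReal (C₂ * t) +
      mAux d μ Q ({y | ENNReal.ofReal t < w y}.indicator w) x := by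
  have hmeas : MeasurableSet {y | ENNReal.ofReal t < w y} := measurableSet_lt measurable_const hw
  refine iSup_le fun r => iSup_le fun hr => iSup_le fun A => iSup_le fun hA => iSup_le fun hAB => ?_
  have hpos : 0 < r ^ Q := by positivity
  rw [ENNReal.div_le_iff (by simpa using hpos) (by simp)]
  calc ∫⁻ y in A, w y ∂μ
      ≤ ∫⁻ y in A, (ENNReal.ofReal t + ({y | ENNReal.ofReal t < w y}.indicator w) y) ∂μ := by
        apply lintegral_mono
        intro y
        by_cases h : ENNReal.ofReal t < w y
        · simp only [Set.indicator, Set.mem_ofPred_eq, h, if_true]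
          exact le_add_self
        · simp only [Set.indicator, Set.mem_ofPred_eq, h, if_false, add_zero]
          exact not_lt.1 h
    _ = ENNReal.ofReal t * μ A + ∫⁻ y in A, ({y | ENNReal.ofReal t < w y}.indicator w) y ∂μ := by
        rw [lintegral_add_left measurable_const]
        simp
    _ ≤ ENNReal.ofReal t * ENNReal.ofReal (C₂ * r ^ Q) + ENNReal.ofReal (r ^ Q) * mAux d μ Q
          ({y | ENNReal.ofReal t < w y}.indicator w) x :=
        add_le_add (mul_le_mul_right ((measure_mono hAB).trans (hup x r hr)) _)
          (le_mAux d μ Q _ x hr hA hAB)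
    _ = _ := by
        rw [add_mul, mul_comm (mAux _ _ _ _ _), ← ENNReal.ofReal_mul ht.le,
          ← ENNReal.ofReal_mul (by positivity)]
        congr 2
        ring

lemma strong_type {X : Type*} [MeasurableSpace X] {d : X → X → ℝ} {μ : Measure X} {A₀ : ℝ}
    (hqm : IsQuasiMetric d A₀) {C₂ Q : ℝ} (hC₂ : 0 < C₂) (hQ : 0 < Q)
    (hup : ∀ (x : X) (r : ℝ), 0 < r → μ (qball d x r) ≤ ENNReal.ofReal (C₂ * r ^ Q))
    {s : ℝ} (hs : 1 < s) :
    ∃ K : ℝ, 0 < K ∧ ∀ w : X → ℝ≥0∞, Measurable w → ∃ Φ : X → ℝ≥0∞, Measurable Φ ∧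
      (∀ x, mAux d μ Q w x ^ s ≤ Φ x) ∧
      ∫⁻ x, Φ x ∂μ ≤ ENNReal.ofReal K * ∫⁻ x, w x ^ s ∂μ := by
  obtain ⟨K0, hK0, hgeo⟩ := geo_sum (c := s - 1) (by linarith)
  have hA0 : 0 < A₀ := by linarith [hqm.1]
  set D := C₂ * (3 * A₀) ^ Q with hD
  have hDpos : 0 < D := by positivity
  set c := C₂ + 1 with hc
  have hcpos : 0 < c := by positivity
  refine ⟨2 ^ s * (D * c) * (K0 * c ^ (s - 1)), by positivity, fun w hw => ?_⟩
  set H : ℤ → Set X := fun k => toMeasurable μ {x | ENNReal.ofReal ((2:ℝ) ^ (k:ℝ)) < mAux d μ Q w x}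
  refine ⟨fun x => ∑' k : ℤ, (H k).indicator
    (fun _ => ENNReal.ofReal ((2:ℝ) ^ (((k:ℝ) + 1) * s))) x, ?_, ?_, ?_⟩
  · exact Measurable.tsum fun k => measurable_const.indicator (measurableSet_toMeasurable _ _)
  · intro x
    refine (dyadic_le (s := s) (by linarith) _).trans ?_
    apply ENNReal.tsum_le_tsum
    intro k
    split_ifs with h
    · rw [Real.rpow_mul (by norm_num), ← ENNReal.ofReal_rpow_of_pos (by positivity),
        ENNReal.rpow_lt_rpow_iff (by linarith)] at h
      have : x ∈ H k := subset_toMeasurable μ _ h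
      rw [Set.indicator_of_mem this]
    · exact zero_le
  · have hk : ∀ k : ℤ, μ (H k) * ENNReal.ofReal ((2:ℝ) ^ (((k:ℝ) + 1) * s)) ≤
        ∫⁻ y, ENNReal.ofReal (2 ^ s * (D * c)) * (w y *
          (if ENNReal.ofReal ((2:ℝ) ^ (k:ℝ)) < ENNReal.ofReal c * w y then
          ENNReal.ofReal ((2:ℝ) ^ ((k:ℝ) * (s - 1))) else 0)) ∂μ := by
      intro k
      set T : ℝ := (2:ℝ) ^ (k:ℝ) with hT
      have hTpos : 0 < T := by positivity
      set w' := {y | ENNReal.ofReal (T / c) < w y}.indicator w with hw'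
      have h1 : μ (H k) ≤ ENNReal.ofReal (D / (T / c)) * ∫⁻ y, w' y ∂μ := by
        rw [measure_toMeasurable]
        refine le_trans (measure_mono ?_) (weak_type hqm hC₂ hQ hup w' (T / c) (by positivity))
        intro x hx
        simp only [Set.mem_ofPred_eq] at hx ⊢
        have h2 := mAux_trunc hC₂ hup w hw (T / c) (by positivity) x
        have h3 : ENNReal.ofReal T = ENNReal.ofReal (C₂ * (T / c)) + ENNReal.ofReal (T / c) := by
          rw [← ENNReal.ofReal_add (by positivity) (by positivity)]
          congr 1
          field_simp
          rw [hc]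
        rw [h3] at hx
        exact lt_of_add_lt_add_left (hx.trans_le h2)
      refine (mul_le_mul_left h1 _).trans (le_of_eq ?_)
      have hset : ∀ y, ENNReal.ofReal (T / c) < w y ↔ ENNReal.ofReal T < ENNReal.ofReal c * w y := by
        intro y
        rw [ENNReal.ofReal_div_of_pos hcpos, ENNReal.div_lt_iff (by left; simpa using hcpos) (by simp),
          mul_comm]
      rw [lintegral_const_mul' _ _ (by simp)]
      have hw'' : ∀ y, (w y *
          (if ENNReal.ofReal T < ENNReal.ofReal c * w y then
          ENNReal.ofReal ((2:ℝ) ^ ((k:ℝ) * (s - 1))) else 0)) =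
          ENNReal.ofReal ((2:ℝ) ^ ((k:ℝ) * (s - 1))) * w' y := by
        intro y
        simp only [hw', Set.indicator, Set.mem_ofPred_eq, hset]
        split_ifs <;> simp [mul_comm]
      simp_rw [hw'']
      rw [lintegral_const_mul' _ _ (by simp), ← mul_assoc, ← ENNReal.ofReal_mul (by positivity),
        mul_right_comm, ← ENNReal.ofReal_mul (by positivity)]
      congr 2
      have e1 : (2:ℝ) ^ (((k:ℝ) + 1) * s) = T * 2 ^ ((k:ℝ) * (s - 1)) * 2 ^ s := by
        rw [hT, ← Real.rpow_add (by norm_num), ← Real.rpow_add (by norm_num)]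
        congr 1; ring
      rw [e1]
      field_simp
    have hmeasB : ∀ k : ℤ, Measurable fun y => ENNReal.ofReal (2 ^ s * (D * c)) * (w y *
          (if ENNReal.ofReal ((2:ℝ) ^ (k:ℝ)) < ENNReal.ofReal c * w y then
          ENNReal.ofReal ((2:ℝ) ^ ((k:ℝ) * (s - 1))) else 0)) := by
      intro k
      refine measurable_const.mul (hw.mul (Measurable.ite ?_ measurable_const measurable_const))
      exact measurableSet_lt measurable_const (measurable_const.mul hw)
    calc _ = ∑' k : ℤ, ∫⁻ x, (H k).indicator
            (fun _ => ENNReal.ofReal ((2:ℝ) ^ (((k:ℝ) + 1) * s))) x ∂μ :=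
          lintegral_tsum fun k => (measurable_const.indicator
            (measurableSet_toMeasurable _ _)).aemeasurable
      _ ≤ ∑' k : ℤ, ∫⁻ y, ENNReal.ofReal (2 ^ s * (D * c)) * (w y *
          (if ENNReal.ofReal ((2:ℝ) ^ (k:ℝ)) < ENNReal.ofReal c * w y then
          ENNReal.ofReal ((2:ℝ) ^ ((k:ℝ) * (s - 1))) else 0)) ∂μ := by
          apply ENNReal.tsum_le_tsum
          intro k
          rw [lintegral_indicator (measurableSet_toMeasurable _ _), setLIntegral_const, mul_comm]
          exact hk k
      _ = ∫⁻ y, ∑' k : ℤ, ENNReal.ofReal (2 ^ s * (D * c)) * (w y *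
          (if ENNReal.ofReal ((2:ℝ) ^ (k:ℝ)) < ENNReal.ofReal c * w y then
          ENNReal.ofReal ((2:ℝ) ^ ((k:ℝ) * (s - 1))) else 0)) ∂μ :=
          (lintegral_tsum fun k => (hmeasB k).aemeasurable).symm
      _ ≤ ∫⁻ y, ENNReal.ofReal (2 ^ s * (D * c) * (K0 * c ^ (s - 1))) * w y ^ s ∂μ := by
          apply lintegral_mono
          intro y
          simp only
          rw [ENNReal.tsum_mul_left, ENNReal.tsum_mul_left,
            ENNReal.ofReal_mul (p := 2 ^ s * (D * c)) (by positivity),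
            mul_assoc (ENNReal.ofReal (2 ^ s * (D * c)))]
          refine mul_le_mul_right ?_ _
          by_cases h0 : w y = 0
          · simp [h0]
          by_cases htop : w y = ⊤
          · have h1 : 0 < K0 * c ^ (s - 1) := by positivity
            have h2 : ENNReal.ofReal (K0 * c ^ (s - 1)) * ⊤ = ⊤ := ENNReal.mul_top (by simpa using h1)
            rw [htop, ENNReal.top_rpow_of_pos (by linarith), h2]
            exact le_top
          obtain ⟨v, hv⟩ : ∃ v : ℝ, v = (w y).toReal := ⟨_, rfl⟩
          have hvpos : 0 < v := hv ▸ ENNReal.toReal_pos h0 htop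
          have hwv : w y = ENNReal.ofReal v := by rw [hv, ENNReal.ofReal_toReal htop]
          rw [hwv, ENNReal.ofReal_rpow_of_pos hvpos, ← ENNReal.ofReal_mul (by positivity),
            ← ENNReal.ofReal_mul (by positivity)]
          refine (mul_le_mul_right (le_trans (ENNReal.tsum_le_tsum fun k => ?_)
            (hgeo (s - 1) le_rfl (c * v) (by positivity))) _).trans (le_of_eq ?_)
          · split_ifs with h1 h2
            · exact le_rfl
            · exact absurd ((ENNReal.ofReal_lt_ofReal_iff (by positivity)).1 h1).le h2
            · exact zero_le
            · exact zero_le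
          · rw [← ENNReal.ofReal_mul hvpos.le, Real.mul_rpow hcpos.le hvpos.le]
            congr 1
            have : v ^ s = v * v ^ (s - 1) := by
              rw [← Real.rpow_one_add' hvpos.le (by linarith)]; congr 1; ring
            rw [this]; ring
      _ = _ := lintegral_const_mul' _ _ (by simp)

end S19

namespace S19

lemma half_tsum (c : ℝ) (hc : 0 ≤ c) :
    ∑' k : ℕ, ENNReal.ofReal (c * (1 / 2) ^ k) = ENNReal.ofReal (c * 2) := by
  rw [← ENNReal.ofReal_tsum_of_nonneg (fun n => by positivity)
    (summable_geometric_two.mul_left c), tsum_mul_left, tsum_geometric_two]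

lemma sigma_exists {X : Type*} [MeasurableSpace X] {d : X → X → ℝ} {μ : Measure X} {A₀ : ℝ}
    (hqm : IsQuasiMetric d A₀) {C₂ Q : ℝ} (hC₂ : 0 < C₂) (hQ : 0 < Q)
    (hup : ∀ (x : X) (r : ℝ), 0 < r → μ (qball d x r) ≤ ENNReal.ofReal (C₂ * r ^ Q)) (x₀ : X) :
    ∃ (σ : X → ℝ≥0∞) (K : ℝ), Measurable σ ∧ 1 ≤ K ∧
      (∀ y, ENNReal.ofReal ((Real.exp 1 + d y x₀) ^ (-(Q + 1))) ≤ σ y) ∧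
      (∀ y, σ y ≤ ENNReal.ofReal K) ∧ ∫⁻ y, σ y ∂μ ≤ ENNReal.ofReal K := by
  obtain ⟨hA₀, hd0, hdz, hsymm, htri⟩ := hqm
  set N := Q + 1 with hN
  set H : ℕ → Set X := fun k => toMeasurable μ (qball d x₀ (2 ^ k)) with hH
  set a : ℕ → ℝ := fun k => 2 ^ N * (2 ^ (-N)) ^ k with ha
  have ha0 : ∀ k, 0 ≤ a k := fun k => by positivity
  have h2N : (2:ℝ) ^ (-N) = 1 / 2 * (2 ^ Q)⁻¹ := by
    rw [hN, neg_add, Real.rpow_add (by norm_num), Real.rpow_neg (by norm_num),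
      Real.rpow_neg (by norm_num)]
    norm_num; ring
  have h2Q : (1:ℝ) ≤ 2 ^ Q := Real.one_le_rpow (by norm_num) hQ.le
  have h2N1 : (1:ℝ) ≤ 2 ^ N := Real.one_le_rpow (by norm_num) (by linarith)
  refine ⟨fun y => ∑' k : ℕ, (H k).indicator (fun _ => ENNReal.ofReal (a k)) y,
    2 ^ N * (C₂ + 1) * 2, ?_, by nlinarith, ?_, ?_, ?_⟩
  · exact Measurable.tsum fun k => measurable_const.indicator (measurableSet_toMeasurable _ _)
  · intro y
    have hd := hd0 y x₀
    have he : 1 ≤ Real.exp 1 := Real.one_le_exp (by norm_num)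
    by_cases h1 : d y x₀ < 1
    · refine le_trans ?_ (ENNReal.le_tsum 0)
      have : y ∈ H 0 := subset_toMeasurable μ _ (by
        simp only [qball, Set.mem_ofPred_eq, pow_zero]; rwa [hsymm])
      rw [Set.indicator_of_mem this]
      apply ENNReal.ofReal_le_ofReal
      simp only [ha, pow_zero, mul_one]
      refine le_trans ?_ h2N1
      exact Real.rpow_le_one_of_one_le_of_nonpos (by linarith) (by linarith)
    · obtain ⟨n, hn1, hn2⟩ := exists_nat_pow_near (not_lt.1 h1) (one_lt_two (α := ℝ))
      refine le_trans ?_ (ENNReal.le_tsum (n + 1))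
      have : y ∈ H (n + 1) := subset_toMeasurable μ _ (by
        simp only [qball, Set.mem_ofPred_eq]; rwa [hsymm])
      rw [Set.indicator_of_mem this]
      apply ENNReal.ofReal_le_ofReal
      have e1 : a (n + 1) = ((2:ℝ) ^ n) ^ (-N) := by
        simp only [ha]
        rw [pow_succ, ← Real.rpow_natCast, ← Real.rpow_mul (by norm_num), ← Real.rpow_natCast,
          ← Real.rpow_mul (by norm_num), ← Real.rpow_add (by norm_num), ← Real.rpow_add (by norm_num)]
        congr 1; ring
      rw [e1]
      apply Real.rpow_le_rpow_of_nonpos (by positivity) (by linarith) (by linarith)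
  · intro y
    calc _ ≤ ∑' k : ℕ, ENNReal.ofReal (2 ^ N * (1 / 2) ^ k) := by
          apply ENNReal.tsum_le_tsum
          intro k
          refine (Set.indicator_le_self _ _ _).trans (ENNReal.ofReal_le_ofReal ?_)
          simp only [ha]
          gcongr
          rw [h2N]
          have : (2 ^ Q : ℝ)⁻¹ ≤ 1 := inv_le_one_of_one_le₀ h2Q
          linarith
      _ = _ := half_tsum _ (by positivity)
      _ ≤ _ := ENNReal.ofReal_le_ofReal (by nlinarith)
  · rw [lintegral_tsum fun k => (measurable_const.indicator
            (measurableSet_toMeasurable _ _)).aemeasurable]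
    calc _ ≤ ∑' k : ℕ, ENNReal.ofReal (2 ^ N * C₂ * (1 / 2) ^ k) := by
          apply ENNReal.tsum_le_tsum
          intro k
          rw [lintegral_indicator (measurableSet_toMeasurable _ _), setLIntegral_const]
          simp only [measure_toMeasurable]
          refine (mul_le_mul_right (hup x₀ (2 ^ k) (by positivity)) _).trans ?_
          rw [← ENNReal.ofReal_mul (ha0 k)]
          apply ENNReal.ofReal_le_ofReal
          apply le_of_eq
          simp only [ha]
          rw [h2N, mul_pow, ← Real.rpow_natCast (2:ℝ) k, ← Real.rpow_mul (by norm_num), mul_comm (k:ℝ) Q,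
            Real.rpow_mul (by norm_num), Real.rpow_natCast]
          field_simp
          rw [← mul_pow, one_div, inv_mul_cancel₀ (by positivity), one_pow]
      _ = _ := half_tsum _ (by positivity)
      _ ≤ _ := ENNReal.ofReal_le_ofReal (by nlinarith)

lemma minorant {X : Type*} [MeasurableSpace X] {μ : Measure X} (F : X → ℝ≥0∞)
    (hF : ∫⁻ x, F x ∂μ ≤ 1) : ∃ h : X → ℝ≥0∞, Measurable h ∧ ∫⁻ x, h x ∂μ ≤ 1 ∧
      ∀ v : X → ℝ≥0∞, Measurable v → v ≤ F → ∀ᵐ x ∂μ, v x ≤ h x := by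
  obtain ⟨h, hm, hle, heq⟩ := exists_measurable_le_lintegral_eq μ F
  have hh1 : ∫⁻ x, h x ∂μ ≤ 1 := heq ▸ hF
  refine ⟨h, hm, hh1, fun v hv hvF => ?_⟩
  have := ae_eq_of_ae_le_of_lintegral_le (μ := μ) (f := h) (g := h ⊔ v)
    (Eventually.of_forall fun x => le_sup_left) (ne_top_of_le_ne_top (by simp) hh1)
    (hm.sup hv).aemeasurable (by
      rw [← heq]
      exact lintegral_mono (sup_le hle hvF))
  filter_upwards [this] with x hx
  rw [hx]
  exact le_sup_right

lemma young_pt {g τ R p P s c : ℝ} (hg : 0 ≤ g) (hτ : 0 < τ) (hs : 1 ≤ s)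
    (hsp : s ≤ p) (hsP : s ≤ P) (hc : |p - P| * |Real.log (max τ R)| ≤ c) (hR : 0 ≤ R) :
    g ≤ τ + R + Real.exp c * τ ^ (1 - P / s) * g ^ (p / s) := by
  set T := max τ R with hT
  have hTpos : 0 < T := lt_of_lt_of_le hτ (le_max_left _ _)
  have hTle : T ≤ τ + R := max_le (by linarith) (by linarith)
  have hnn : 0 ≤ Real.exp c * τ ^ (1 - P / s) * g ^ (p / s) := by positivity
  by_cases hgT : g ≤ T
  · linarith
  have hgT' : T < g := not_le.1 hgT
  have hgpos : 0 < g := hTpos.trans hgT'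
  have hs0 : 0 < s := by linarith
  have h1 : g ≤ T ^ (1 - p / s) * g ^ (p / s) := by
    have h2 : g ^ (1 - p / s) ≤ T ^ (1 - p / s) :=
      Real.rpow_le_rpow_of_nonpos hTpos hgT'.le (by
        have : 1 ≤ p / s := by rw [le_div_iff₀ hs0]; linarith
        linarith)
    calc g = g ^ (1 - p / s) * g ^ (p / s) := by
          rw [← Real.rpow_add hgpos]; simp
      _ ≤ _ := by gcongr
  have h3 : T ^ (1 - p / s) ≤ Real.exp c * τ ^ (1 - P / s) := by
    have h4 : T ^ (1 - p / s) = T ^ ((P - p) / s) * T ^ (1 - P / s) := by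
      rw [← Real.rpow_add hTpos]; congr 1; ring
    rw [h4]
    have h5 : T ^ ((P - p) / s) ≤ Real.exp c := by
      rw [Real.rpow_def_of_pos hTpos]
      apply Real.exp_le_exp.2
      calc Real.log T * ((P - p) / s) ≤ |Real.log T * ((P - p) / s)| := le_abs_self _
        _ = |p - P| * |Real.log T| / s := by
            rw [abs_mul, abs_div, abs_of_pos hs0, abs_sub_comm]; ring
        _ ≤ |p - P| * |Real.log T| := div_le_self (by positivity) hs
        _ ≤ c := hc
    have h6 : T ^ (1 - P / s) ≤ τ ^ (1 - P / s) :=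
      Real.rpow_le_rpow_of_nonpos hτ (le_max_left _ _) (by
        have : 1 ≤ P / s := by rw [le_div_iff₀ hs0]; linarith
        linarith)
    gcongr
  have h7 : T ^ (1 - p / s) * g ^ (p / s) ≤ Real.exp c * τ ^ (1 - P / s) * g ^ (p / s) := by
    gcongr
  linarith

lemma avg {X : Type*} [MeasurableSpace X] {μ : Measure X} {g p R : X → ℝ} {σ h : X → ℝ≥0∞}
    (hgm : Measurable g) (hg : ∀ y, 0 ≤ g y) (hR : ∀ y, 0 ≤ R y)
    (hσm : Measurable σ) (hσ : ∀ y, ENNReal.ofReal (R y) ≤ σ y)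
    (hh : ∀ v : X → ℝ≥0∞, Measurable v → v ≤ (fun y => ENNReal.ofReal (g y ^ p y)) →
      ∀ᵐ x ∂μ, v x ≤ h x)
    {s P τ c : ℝ} (hs : 1 ≤ s) (hsP : s ≤ P) (hsp : ∀ y, s ≤ p y) (hτ : 0 < τ)
    {A : Set X} (hA : MeasurableSet A)
    (hc : ∀ y ∈ A, |p y - P| * |Real.log (max τ (R y))| ≤ c) :
    ∫⁻ y in A, ENNReal.ofReal (g y) ∂μ ≤ ENNReal.ofReal τ * μ A + ∫⁻ y in A, σ y ∂μ +
      ENNReal.ofReal (Real.exp c * τ ^ (1 - P / s)) * ∫⁻ y in A, h y ^ (1 / s) ∂μ := by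
  set κ := Real.exp c * τ ^ (1 - P / s) with hκ
  have hκpos : 0 < κ := by positivity
  have hs0 : 0 < s := by linarith
  have hgm' : Measurable fun y => ENNReal.ofReal (g y) := hgm.ennreal_ofReal
  set v : X → ℝ≥0∞ := A.indicator
    (fun y => ((ENNReal.ofReal (g y) - (ENNReal.ofReal τ + σ y)) / ENNReal.ofReal κ) ^ s) with hv
  have hvm : Measurable v := by
    refine Measurable.indicator ?_ hA
    exact (((hgm'.sub (measurable_const.add hσm)).div_const _).pow_const _)
  have hvF : v ≤ fun y => ENNReal.ofReal (g y ^ p y) := by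
    intro y
    by_cases hy : y ∈ A
    · simp only [hv, Set.indicator_of_mem hy]
      have h1 := young_pt (hg y) hτ hs (hsp y) hsP (hc y hy) (hR y)
      rw [← hκ] at h1
      have h2 : ENNReal.ofReal (g y) ≤ ENNReal.ofReal (g y ^ (p y / s)) * ENNReal.ofReal κ +
          (ENNReal.ofReal τ + σ y) := by
        have hgp : 0 ≤ g y ^ (p y / s) := Real.rpow_nonneg (hg y) _
        have := hR y
        calc ENNReal.ofReal (g y) ≤ ENNReal.ofReal (τ + R y + κ * g y ^ (p y / s)) :=
              ENNReal.ofReal_le_ofReal h1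
          _ = ENNReal.ofReal (g y ^ (p y / s)) * ENNReal.ofReal κ +
              (ENNReal.ofReal τ + ENNReal.ofReal (R y)) := by
              rw [ENNReal.ofReal_add (by positivity) (by positivity),
                ENNReal.ofReal_add (by positivity) (by positivity),
                ENNReal.ofReal_mul hκpos.le]
              ring
          _ ≤ _ := by gcongr; exact hσ y
      have h3 := tsub_le_iff_right.2 h2
      have h4 := ENNReal.div_le_of_le_mul h3
      calc _ ≤ (ENNReal.ofReal (g y ^ (p y / s))) ^ s := ENNReal.rpow_le_rpow h4 hs0.le
        _ = _ := by
          rw [ENNReal.ofReal_rpow_of_nonneg (Real.rpow_nonneg (hg y) _) hs0.le,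
            ← Real.rpow_mul (hg y), div_mul_cancel₀ _ hs0.ne']
    · simp only [hv, Set.indicator_of_notMem hy]; exact zero_le
  have hae := hh v hvm hvF
  calc ∫⁻ y in A, ENNReal.ofReal (g y) ∂μ
      ≤ ∫⁻ y in A, ((ENNReal.ofReal τ + σ y) + ENNReal.ofReal κ * h y ^ (1 / s)) ∂μ := by
        apply lintegral_mono_ae
        refine (ae_restrict_iff' hA).2 ?_
        filter_upwards [hae] with y hy hyA
        simp only [hv, Set.indicator_of_mem hyA] at hy
        have h1 := ENNReal.rpow_le_rpow hy (show 0 ≤ 1 / s by positivity)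
        rw [← ENNReal.rpow_mul, mul_one_div_cancel hs0.ne', ENNReal.rpow_one] at h1
        rw [ENNReal.div_le_iff (by simpa using hκpos) (by simp)] at h1
        have := tsub_le_iff_left.1 h1
        rwa [mul_comm] 
    _ = _ := by
        rw [lintegral_add_left (show Measurable fun y => ENNReal.ofReal τ + σ y from
            measurable_const.add hσm), lintegral_add_left measurable_const,
          lintegral_const_mul' _ _ (by simp)]
        simp

end S19

namespace S19

/-- Standing hypotheses. -/
structure Setup {X : Type*} [MeasurableSpace X] (d : X → X → ℝ) (μ : Measure X)
    (A₀ C₂ Q : ℝ) (p : X → ℝ) (C₀ : ℝ) (x₀ : X) (Cinf pinf pm pM : ℝ) : Prop where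
  hqm : IsQuasiMetric d A₀
  hC₂ : 0 < C₂
  hQ : 0 < Q
  hup : ∀ (x : X) (r : ℝ), 0 < r → μ (qball d x r) ≤ ENNReal.ofReal (C₂ * r ^ Q)
  hinf : μ Set.univ = ⊤
  hLH0 : LH0 d p C₀
  hLHinf : LHinf d p x₀ Cinf pinf
  hpm1 : 1 < pm
  hbounds : ∀ x, pm ≤ p x ∧ p x ≤ pM

section
variable {X : Type*} [MeasurableSpace X] {d : X → X → ℝ} {μ : Measure X}
    {A₀ C₂ Q : ℝ} {p : X → ℝ} {C₀ : ℝ} {x₀ : X} {Cinf pinf pm pM : ℝ}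

lemma Setup.d0 (S : Setup d μ A₀ C₂ Q p C₀ x₀ Cinf pinf pm pM) (x y : X) : 0 ≤ d x y := S.hqm.2.1 x y

lemma Setup.rho_ge (S : Setup d μ A₀ C₂ Q p C₀ x₀ Cinf pinf pm pM) (x : X) :
    Real.exp 1 ≤ Real.exp 1 + d x x₀ := by linarith [S.d0 x x₀]

lemma Setup.rho_pos (S : Setup d μ A₀ C₂ Q p C₀ x₀ Cinf pinf pm pM) (x : X) :
    0 < Real.exp 1 + d x x₀ := by linarith [S.d0 x x₀, Real.exp_pos 1]

lemma Setup.log_rho (S : Setup d μ A₀ C₂ Q p C₀ x₀ Cinf pinf pm pM) (x : X) :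
    1 ≤ Real.log (Real.exp 1 + d x x₀) := by
  rw [Real.le_log_iff_exp_le (S.rho_pos x)]; exact S.rho_ge x

lemma Setup.inf_log (S : Setup d μ A₀ C₂ Q p C₀ x₀ Cinf pinf pm pM) (x : X) :
    |p x - pinf| * Real.log (Real.exp 1 + d x x₀) ≤ Cinf := by
  have := S.hLHinf x
  rwa [le_div_iff₀ (by linarith [S.log_rho x])] at this

lemma Setup.Cinf_nonneg (S : Setup d μ A₀ C₂ Q p C₀ x₀ Cinf pinf pm pM) : 0 ≤ Cinf := by
  refine le_trans ?_ (S.inf_log x₀)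
  have := S.log_rho x₀
  positivity

lemma Setup.R_pos (S : Setup d μ A₀ C₂ Q p C₀ x₀ Cinf pinf pm pM) (x : X) :
    0 < (Real.exp 1 + d x x₀) ^ (-(Q + 1)) := Real.rpow_pos_of_pos (S.rho_pos x) _

lemma Setup.R_le_one (S : Setup d μ A₀ C₂ Q p C₀ x₀ Cinf pinf pm pM) (x : X) :
    (Real.exp 1 + d x x₀) ^ (-(Q + 1)) ≤ 1 := by
  apply Real.rpow_le_one_of_one_le_of_nonpos
  · linarith [S.rho_ge x, Real.one_le_exp (show (0:ℝ) ≤ 1 by norm_num)]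
  · linarith [S.hQ]

lemma Setup.far (S : Setup d μ A₀ C₂ Q p C₀ x₀ Cinf pinf pm pM) (M : ℝ) : ∃ x, M ≤ d x x₀ := by
  by_contra! hcon
  have h1 : (Set.univ : Set X) ⊆ qball d x₀ (|M| + 1) := by
    intro x _
    simp only [qball, Set.mem_ofPred_eq]
    rw [S.hqm.2.2.2.1]
    linarith [hcon x, le_abs_self M]
  have h2 := (measure_mono h1).trans (S.hup x₀ (|M| + 1) (by positivity))
  rw [S.hinf] at h2
  exact absurd h2 (by simp)

lemma Setup.near (S : Setup d μ A₀ C₂ Q p C₀ x₀ Cinf pinf pm pM) (ε : ℝ) (hε : 0 < ε) :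
    ∃ x, |p x - pinf| ≤ ε := by
  obtain ⟨x, hx⟩ := S.far (Real.exp (Cinf / ε))
  refine ⟨x, ?_⟩
  have h1 : Cinf / ε ≤ Real.log (Real.exp 1 + d x x₀) := by
    rw [Real.le_log_iff_exp_le (S.rho_pos x)]
    linarith [Real.exp_pos 1]
  have h2 := S.inf_log x
  have h3 := S.log_rho x
  rw [div_le_iff₀ hε] at h1
  by_contra! h4
  nlinarith

lemma Setup.pinf_bounds (S : Setup d μ A₀ C₂ Q p C₀ x₀ Cinf pinf pm pM) :
    pm ≤ pinf ∧ pinf ≤ pM := by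
  constructor
  · refine le_of_forall_pos_le_add fun ε hε => ?_
    obtain ⟨x, hx⟩ := S.near ε hε
    linarith [(abs_le.1 hx).2, (S.hbounds x).1]
  · refine le_of_forall_pos_le_add fun ε hε => ?_
    obtain ⟨x, hx⟩ := S.near ε hε
    linarith [(abs_le.1 hx).1, (S.hbounds x).2]

lemma Setup.condInf (S : Setup d μ A₀ C₂ Q p C₀ x₀ Cinf pinf pm pM) (y : X) {τ : ℝ}
    (hτ : 0 < τ) (hτ1 : τ ≤ 1) :
    |p y - pinf| * |Real.log (max τ ((Real.exp 1 + d y x₀) ^ (-(Q + 1))))| ≤ (Q + 1) * Cinf := by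
  set T := max τ ((Real.exp 1 + d y x₀) ^ (-(Q + 1))) with hT
  have hT0 : 0 < T := lt_of_lt_of_le hτ (le_max_left _ _)
  have hT1 : T ≤ 1 := max_le hτ1 (S.R_le_one y)
  rw [abs_of_nonpos (Real.log_nonpos hT0.le hT1)]
  have h1 : -Real.log T ≤ (Q + 1) * Real.log (Real.exp 1 + d y x₀) := by
    have := Real.log_le_log (S.R_pos y) (le_max_right τ _)
    rw [Real.log_rpow (S.rho_pos y)] at this
    linarith
  have h2 := S.inf_log y
  have hQ := S.hQ
  have h3 : |p y - pinf| * -Real.log T ≤ |p y - pinf| * ((Q + 1) * Real.log (Real.exp 1 + d y x₀)) := by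
    gcongr
  nlinarith

lemma Setup.cond (S : Setup d μ A₀ C₂ Q p C₀ x₀ Cinf pinf pm pM) : ∃ c : ℝ, ∀ (x y : X) (r τ : ℝ),
    0 < r → d x y < r → (Real.exp 1 + d x x₀) ^ (-(Q + 1)) ≤ τ → τ ≤ 1 + C₂ + r ^ (-Q) →
    |p y - p x| * |Real.log (max τ ((Real.exp 1 + d y x₀) ^ (-(Q + 1))))| ≤ c := by
  have hQ := S.hQ
  have hC₂ := S.hC₂
  have hCi := S.Cinf_nonneg
  have hpM : 0 < pM := by linarith [S.hpm1, (S.hbounds x₀).1, (S.hbounds x₀).2]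
  have hl1 : 0 ≤ Real.log (1 + C₂ + 4 ^ Q) := Real.log_nonneg (by
    have : (0:ℝ) < 4 ^ Q := by positivity
    linarith)
  have hl2 : 0 ≤ Real.log (2 + C₂) := Real.log_nonneg (by linarith)
  have hm0 : 0 ≤ max C₀ 0 := le_max_right _ _
  refine ⟨2 * ((Q + 1) * Cinf) + pM * Real.log (1 + C₂ + 4 ^ Q) +
    max C₀ 0 * (Real.log (2 + C₂) + Q), ?_⟩
  have t1 : 0 ≤ 2 * ((Q + 1) * Cinf) := by positivity
  have t2 : 0 ≤ pM * Real.log (1 + C₂ + 4 ^ Q) := by positivity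
  have t3 : 0 ≤ max C₀ 0 * (Real.log (2 + C₂) + Q) := by positivity
  intro x y r τ hr hxy hτ1 hτ2
  have hτ0 : 0 < τ := lt_of_lt_of_le (S.R_pos x) hτ1
  set T := max τ ((Real.exp 1 + d y x₀) ^ (-(Q + 1))) with hT
  have hT0 : 0 < T := lt_of_lt_of_le hτ0 (le_max_left _ _)
  have hrQ : 0 < r ^ (-Q) := by positivity
  by_cases hT1 : 1 ≤ T
  · rw [abs_of_nonneg (Real.log_nonneg hT1)]
    have hTle : T ≤ 1 + C₂ + r ^ (-Q) := max_le hτ2 (by linarith [S.R_le_one y])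
    have hlog := Real.log_le_log hT0 hTle
    by_cases hr4 : 1 / 4 ≤ r
    · have h1 : r ^ (-Q) ≤ 4 ^ Q := by
        calc r ^ (-Q) ≤ (1 / 4 : ℝ) ^ (-Q) :=
              Real.rpow_le_rpow_of_nonpos (by norm_num) hr4 (by linarith)
          _ = 4 ^ Q := by
              rw [one_div, Real.inv_rpow (by norm_num), Real.rpow_neg (by norm_num), inv_inv]
      have h2 : Real.log T ≤ Real.log (1 + C₂ + 4 ^ Q) :=
        hlog.trans (Real.log_le_log (by positivity) (by linarith))
      have h3 : |p y - p x| ≤ pM := by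
        rw [abs_le]
        have := S.hbounds x; have := S.hbounds y; have := S.hpm1
        constructor <;> linarith
      have : |p y - p x| * Real.log T ≤ pM * Real.log (1 + C₂ + 4 ^ Q) :=
        mul_le_mul h3 h2 (Real.log_nonneg hT1) hpM.le
      linarith
    · have hr4' : r < 1 / 4 := not_le.1 hr4
      by_cases hd : d x y = 0
      · have : x = y := (S.hqm.2.2.1 x y).1 hd
        rw [this]; simp only [sub_self, abs_zero, zero_mul]; linarith
      · have hd0 : 0 < d x y := lt_of_le_of_ne (S.d0 x y) (Ne.symm hd)
        have hl4 : 1 ≤ -Real.log (d x y) := by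
          rw [le_neg, Real.log_le_iff_le_exp hd0]
          have : Real.exp 1 ≤ 4 := by linarith [Real.exp_one_lt_three]
          rw [Real.exp_neg]
          have h5 : (4:ℝ)⁻¹ ≤ (Real.exp 1)⁻¹ := inv_anti₀ (Real.exp_pos 1) this
          norm_num at h5 hr4'
          linarith
        have h1 := S.hLH0 x y (by linarith)
        rw [← neg_div_neg_eq, neg_neg, le_div_iff₀ (by linarith)] at h1
        rw [abs_sub_comm] at h1
        have h2 : Real.log (1 + C₂ + r ^ (-Q)) ≤ (Real.log (2 + C₂) + Q) * (-Real.log (d x y)) := by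
          have hr1 : 1 ≤ r ^ (-Q) := Real.one_le_rpow_of_pos_of_le_one_of_nonpos hr (by linarith) (by linarith)
          have h3 : Real.log (1 + C₂ + r ^ (-Q)) ≤ Real.log ((2 + C₂) * r ^ (-Q)) :=
            Real.log_le_log (by positivity) (by nlinarith)
          rw [Real.log_mul (by positivity) (by positivity), Real.log_rpow hr] at h3
          have h4 := Real.log_lt_log hd0 hxy
          nlinarith
        have h6 : |p y - p x| * Real.log T ≤
            |p y - p x| * ((Real.log (2 + C₂) + Q) * (-Real.log (d x y))) := by
          have := hlog.trans h2
          gcongr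
        have h7 : |p y - p x| * ((Real.log (2 + C₂) + Q) * (-Real.log (d x y))) ≤
            max C₀ 0 * (Real.log (2 + C₂) + Q) := by
          have h8 : |p y - p x| * -Real.log (d x y) ≤ max C₀ 0 := h1.trans (le_max_left _ _)
          have h9 := mul_le_mul_of_nonneg_right h8 (show 0 ≤ Real.log (2 + C₂) + Q by positivity)
          linarith
        linarith
  · have hT1' : T ≤ 1 := (not_le.1 hT1).le
    rw [abs_of_nonpos (Real.log_nonpos hT0.le hT1')]
    have hx : -Real.log T ≤ (Q + 1) * Real.log (Real.exp 1 + d x x₀) := by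
      have := Real.log_le_log (S.R_pos x) (hτ1.trans (le_max_left τ ((Real.exp 1 + d y x₀) ^ (-(Q + 1)))))
      rw [Real.log_rpow (S.rho_pos x)] at this
      rw [← hT] at this
      linarith
    have hy : -Real.log T ≤ (Q + 1) * Real.log (Real.exp 1 + d y x₀) := by
      have := Real.log_le_log (S.R_pos y) (le_max_right τ _)
      rw [Real.log_rpow (S.rho_pos y)] at this
      linarith
    have hlT : 0 ≤ -Real.log T := by linarith [Real.log_nonpos hT0.le hT1']
    have hix := S.inf_log x
    have hiy := S.inf_log y
    have h1 : |p y - p x| ≤ |p y - pinf| + |p x - pinf| := by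
      rw [abs_sub_comm (p x)]; exact abs_sub_le _ _ _
    have h2 : |p y - p x| * -Real.log T ≤ (|p y - pinf| + |p x - pinf|) * -Real.log T := by gcongr
    have h3 : |p y - pinf| * -Real.log T ≤ |p y - pinf| * ((Q + 1) * Real.log (Real.exp 1 + d y x₀)) := by
      gcongr
    have h4 : |p x - pinf| * -Real.log T ≤ |p x - pinf| * ((Q + 1) * Real.log (Real.exp 1 + d x x₀)) := by
      gcongr
    nlinarith

end

end S19

namespace S19

/-- The data attached to a normalised function. -/
structure GData {X : Type*} [MeasurableSpace X] (d : X → X → ℝ) (μ : Measure X)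
    (Q : ℝ) (p : X → ℝ) (x₀ : X) (g : X → ℝ) (h σ : X → ℝ≥0∞) (Kσ : ℝ) : Prop where
  hgm : Measurable g
  hg : ∀ y, 0 ≤ g y
  hhm : Measurable h
  hh1 : ∫⁻ y, h y ∂μ ≤ 1
  hh : ∀ v : X → ℝ≥0∞, Measurable v → v ≤ (fun y => ENNReal.ofReal (g y ^ p y)) →
      ∀ᵐ x ∂μ, v x ≤ h x
  hσm : Measurable σ
  hK : 1 ≤ Kσ
  hσ : ∀ y, ENNReal.ofReal ((Real.exp 1 + d y x₀) ^ (-(Q + 1))) ≤ σ y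
  hσK : ∀ y, σ y ≤ ENNReal.ofReal Kσ
  hσI : ∫⁻ y, σ y ∂μ ≤ ENNReal.ofReal Kσ

/-- The log-Hoelder comparison. -/
def CondC {X : Type*} (d : X → X → ℝ) (Q C₂ : ℝ) (p : X → ℝ) (x₀ : X) (c : ℝ) : Prop :=
  ∀ (x y : X) (r τ : ℝ),
    0 < r → d x y < r → (Real.exp 1 + d x x₀) ^ (-(Q + 1)) ≤ τ → τ ≤ 1 + C₂ + r ^ (-Q) →
    |p y - p x| * |Real.log (max τ ((Real.exp 1 + d y x₀) ^ (-(Q + 1))))| ≤ c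

section
variable {X : Type*} [MeasurableSpace X] {d : X → X → ℝ} {μ : Measure X}
    {A₀ C₂ Q : ℝ} {p : X → ℝ} {C₀ : ℝ} {x₀ : X} {Cinf pinf pm pM : ℝ}
    {g : X → ℝ} {h σ : X → ℝ≥0∞} {Kσ : ℝ} {c : ℝ}

lemma sum3 {a b e : ℝ≥0∞} {a' b' e' K : ℝ} (ha : a ≤ ENNReal.ofReal a') (hb : b ≤ ENNReal.ofReal b')
    (he : e ≤ ENNReal.ofReal e') (ha' : 0 ≤ a') (hb' : 0 ≤ b') (he' : 0 ≤ e')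
    (hK : a' + b' + e' ≤ K) : a + b + e ≤ ENNReal.ofReal K := by
  refine le_trans (add_le_add (add_le_add ha hb) he) ?_
  rw [← ENNReal.ofReal_add ha' hb', ← ENNReal.ofReal_add (by positivity) he']
  exact ENNReal.ofReal_le_ofReal hK

lemma muA (S : Setup d μ A₀ C₂ Q p C₀ x₀ Cinf pinf pm pM) {x : X} {r : ℝ} (hr : 0 < r)
    {A : Set X} (hAB : A ⊆ qball d x r) : μ A ≤ ENNReal.ofReal (C₂ * r ^ Q) :=
  (measure_mono hAB).trans (S.hup x r hr)

lemma sigmaA (S : Setup d μ A₀ C₂ Q p C₀ x₀ Cinf pinf pm pM) (G : GData d μ Q p x₀ g h σ Kσ)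
    {x : X} {r : ℝ} (hr : 0 < r)
    {A : Set X} (hAB : A ⊆ qball d x r) :
    ∫⁻ y in A, σ y ∂μ ≤ ENNReal.ofReal (Kσ * (C₂ * r ^ Q)) := by
  have hK : 0 ≤ Kσ := by linarith [G.hK]
  calc ∫⁻ y in A, σ y ∂μ ≤ ∫⁻ y in A, ENNReal.ofReal Kσ ∂μ := lintegral_mono fun y => G.hσK y
    _ = ENNReal.ofReal Kσ * μ A := by rw [setLIntegral_const]
    _ ≤ ENNReal.ofReal Kσ * ENNReal.ofReal (C₂ * r ^ Q) := mul_le_mul_right (muA S hr hAB) _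
    _ = _ := by rw [ENNReal.ofReal_mul hK]

lemma L1a (S : Setup d μ A₀ C₂ Q p C₀ x₀ Cinf pinf pm pM) (G : GData d μ Q p x₀ g h σ Kσ)
    (hcc : CondC d Q C₂ p x₀ c)
    {x : X} {r : ℝ} (hr : 0 < r) (hr1 : r ≤ 1) {A : Set X} (hA : MeasurableSet A)
    (hAB : A ⊆ qball d x r) :
    ∫⁻ y in A, ENNReal.ofReal (g y) ∂μ ≤
      ENNReal.ofReal ((C₂ + Kσ * C₂ + Real.exp c) * r ^ Q * r ^ (-(Q / p x))) := by
  have hQ := S.hQ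
  have hC₂ := S.hC₂
  have hK : 0 < Kσ := by linarith [G.hK]
  have hpx : 1 < p x := by linarith [S.hpm1, (S.hbounds x).1]
  have hpp : ∀ y, 1 ≤ p y := fun y => by linarith [S.hpm1, (S.hbounds y).1]
  have hτ0 : 0 < r ^ (-(Q / p x)) := by positivity
  have hQp : Q / p x ≤ Q := div_le_self hQ.le hpx.le
  have hQp0 : 0 < Q / p x := by positivity
  have hτ1 : 1 ≤ r ^ (-(Q / p x)) :=
    Real.one_le_rpow_of_pos_of_le_one_of_nonpos hr hr1 (by linarith)
  have hτ2 : r ^ (-(Q / p x)) ≤ r ^ (-Q) :=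
    Real.rpow_le_rpow_of_exponent_ge hr hr1 (by linarith)
  have key := avg (s := 1) (P := p x) (τ := r ^ (-(Q / p x))) (c := c) G.hgm G.hg
    (fun y => (S.R_pos y).le) G.hσm G.hσ G.hh le_rfl hpx.le hpp hτ0 hA
    (fun y hy => hcc x y r _ hr (hAB hy) ((S.R_le_one x).trans hτ1) (by linarith))
  refine key.trans ?_
  have hrQ : 0 < r ^ Q := by positivity
  have he : (r ^ (-(Q / p x))) ^ (1 - p x / 1) = r ^ Q * r ^ (-(Q / p x)) := by
    rw [← Real.rpow_mul hr.le, ← Real.rpow_add hr]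
    congr 1
    field_simp
    ring
  refine sum3 (a' := r ^ (-(Q / p x)) * (C₂ * r ^ Q)) (b' := Kσ * (C₂ * r ^ Q))
    (e' := Real.exp c * (r ^ Q * r ^ (-(Q / p x)))) ?_ (sigmaA S G hr hAB) ?_
    (by positivity) (by positivity) (by positivity) ?_
  · rw [ENNReal.ofReal_mul hτ0.le]
    exact mul_le_mul_right (muA S hr hAB) _
  · rw [he]
    calc _ ≤ ENNReal.ofReal (Real.exp c * (r ^ Q * r ^ (-(Q / p x)))) * 1 := by
            refine mul_le_mul_right ?_ _
            simp only [div_one, ENNReal.rpow_one]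
            exact (setLIntegral_le_lintegral _ _).trans G.hh1
      _ = _ := mul_one _
  · have : Kσ * (C₂ * r ^ Q) * 1 ≤ Kσ * (C₂ * r ^ Q) * r ^ (-(Q / p x)) := by gcongr
    nlinarith

lemma L1b (S : Setup d μ A₀ C₂ Q p C₀ x₀ Cinf pinf pm pM) (G : GData d μ Q p x₀ g h σ Kσ)
    {x : X} {r : ℝ} (hr1 : 1 ≤ r) {A : Set X} (hA : MeasurableSet A)
    (hAB : A ⊆ qball d x r) :
    ∫⁻ y in A, ENNReal.ofReal (g y) ∂μ ≤
      ENNReal.ofReal ((C₂ + Kσ + Real.exp ((Q + 1) * Cinf)) * r ^ Q * r ^ (-(Q / pinf))) := by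
  have hQ := S.hQ
  have hC₂ := S.hC₂
  have hr : 0 < r := by linarith
  have hK : 0 < Kσ := by linarith [G.hK]
  have hpx : 1 < pinf := by linarith [S.hpm1, S.pinf_bounds.1]
  have hpp : ∀ y, 1 ≤ p y := fun y => by linarith [S.hpm1, (S.hbounds y).1]
  have hτ0 : 0 < r ^ (-(Q / pinf)) := by positivity
  have hQp : Q / pinf ≤ Q := div_le_self hQ.le hpx.le
  have hQp0 : 0 < Q / pinf := by positivity
  have hτ1 : r ^ (-(Q / pinf)) ≤ 1 :=
    Real.rpow_le_one_of_one_le_of_nonpos hr1 (by linarith)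
  have key := avg (s := 1) (P := pinf) (τ := r ^ (-(Q / pinf))) (c := (Q + 1) * Cinf) G.hgm G.hg
    (fun y => (S.R_pos y).le) G.hσm G.hσ G.hh le_rfl hpx.le hpp hτ0 hA
    (fun y hy => S.condInf y hτ0 hτ1)
  refine key.trans ?_
  have hrQ : 0 < r ^ Q := by positivity
  have he : (r ^ (-(Q / pinf))) ^ (1 - pinf / 1) = r ^ Q * r ^ (-(Q / pinf)) := by
    rw [← Real.rpow_mul hr.le, ← Real.rpow_add hr]
    congr 1
    field_simp
    ring
  refine sum3 (a' := r ^ (-(Q / pinf)) * (C₂ * r ^ Q)) (b' := Kσ)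
    (e' := Real.exp ((Q + 1) * Cinf) * (r ^ Q * r ^ (-(Q / pinf)))) ?_
    ((setLIntegral_le_lintegral _ _).trans G.hσI) ?_
    (by positivity) (by positivity) (by positivity) ?_
  · rw [ENNReal.ofReal_mul hτ0.le]
    exact mul_le_mul_right (muA S hr hAB) _
  · rw [he]
    calc _ ≤ ENNReal.ofReal (Real.exp ((Q + 1) * Cinf) * (r ^ Q * r ^ (-(Q / pinf)))) * 1 := by
            refine mul_le_mul_right ?_ _
            simp only [div_one, ENNReal.rpow_one]
            exact (setLIntegral_le_lintegral _ _).trans G.hh1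
      _ = _ := mul_one _
  · have h1 : 1 ≤ r ^ Q * r ^ (-(Q / pinf)) := by
      rw [← Real.rpow_add hr]
      exact Real.one_le_rpow hr1 (by linarith)
    nlinarith

lemma rpow_theta_le {W θ : ℝ} (hW : 0 ≤ W) (hθ0 : 0 < θ) (hθ1 : θ ≤ 1) : W ^ θ ≤ 1 + W := by
  by_cases h : W ≤ 1
  · linarith [Real.rpow_le_one hW h hθ0.le]
  · have h' : 1 ≤ W := (not_le.1 h).le
    have := Real.rpow_le_rpow_of_exponent_le h' hθ1
    rw [Real.rpow_one] at this
    linarith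

lemma L2 (S : Setup d μ A₀ C₂ Q p C₀ x₀ Cinf pinf pm pM) (G : GData d μ Q p x₀ g h σ Kσ)
    (hcc : CondC d Q C₂ p x₀ c)
    {x : X} {m : ℝ} (hm : 0 ≤ m)
    (hM : mAux d μ Q (fun y => max (h y ^ (1 / pm)) (σ y)) x ≤ ENNReal.ofReal m)
    {r : ℝ} (hr : 0 < r) {A : Set X} (hA : MeasurableSet A)
    (hAB : A ⊆ qball d x r) :
    ∫⁻ y in A, ENNReal.ofReal (g y) ∂μ ≤
      ENNReal.ofReal ((C₂ + max 1 (Kσ * C₂) + Real.exp c) *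
        max (m ^ (pm / p x)) ((Real.exp 1 + d x x₀) ^ (-(Q + 1))) * r ^ Q) := by
  have hQ := S.hQ
  have hC₂ := S.hC₂
  have hpm := S.hpm1
  have hK : 0 < Kσ := by linarith [G.hK]
  have hpx : pm ≤ p x := (S.hbounds x).1
  have hpx0 : 0 < p x := by linarith
  have hrQ : 0 < r ^ Q := by positivity
  set θ := pm / p x with hθ
  have hθ0 : 0 < θ := by positivity
  have hθ1 : θ ≤ 1 := by rw [hθ, div_le_one hpx0]; exact hpx
  have hw := (le_mAux d μ Q (fun y => max (h y ^ (1 / pm)) (σ y)) x hr hA hAB).trans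
    (mul_le_mul_right hM _)
  rw [← ENNReal.ofReal_mul hrQ.le] at hw
  set I := ∫⁻ y in A, h y ^ (1 / pm) ∂μ with hI
  have hI1 : I ≤ ENNReal.ofReal (r ^ Q * m) :=
    (lintegral_mono fun y => le_max_left _ _).trans hw
  have hItop : I ≠ ⊤ := ne_top_of_le_ne_top (by simp) hI1
  have hI2 : I ≤ ENNReal.ofReal (C₂ * r ^ Q + 1) := by
    calc I ≤ ∫⁻ y in A, (1 + h y) ∂μ := by
          refine lintegral_mono fun y => ?_
          by_cases h1 : h y ≤ 1
          · exact (ENNReal.rpow_le_one h1 (by positivity)).trans (by simp)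
          · have h1' : 1 ≤ h y := (not_le.1 h1).le
            calc h y ^ (1 / pm) ≤ h y ^ (1:ℝ) :=
                  ENNReal.rpow_le_rpow_of_exponent_le h1' (by
                    rw [div_le_one (by linarith)]; linarith)
              _ = h y := ENNReal.rpow_one _
              _ ≤ 1 + h y := le_add_self
      _ = μ A + ∫⁻ y in A, h y ∂μ := by
          rw [lintegral_add_left measurable_const, setLIntegral_const, one_mul]
      _ ≤ ENNReal.ofReal (C₂ * r ^ Q) + 1 :=
          add_le_add (muA S hr hAB) ((setLIntegral_le_lintegral _ _).trans G.hh1)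
      _ = _ := by rw [ENNReal.ofReal_add (by positivity) (by norm_num), ENNReal.ofReal_one]
  set W := I.toReal / r ^ Q with hW
  have hW0 : 0 ≤ W := by positivity
  have hWI : I = ENNReal.ofReal (W * r ^ Q) := by
    rw [hW, div_mul_cancel₀ _ hrQ.ne', ENNReal.ofReal_toReal hItop]
  have hWm : W ≤ m := by
    rw [hWI, ENNReal.ofReal_le_ofReal_iff (by positivity), mul_comm] at hI1
    exact le_of_mul_le_mul_left hI1 hrQ
  have hWb : W ≤ C₂ + r ^ (-Q) := by
    rw [hWI, ENNReal.ofReal_le_ofReal_iff (by positivity)] at hI2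
    rw [Real.rpow_neg hr.le]
    refine le_of_mul_le_mul_right ?_ hrQ
    rw [add_mul, inv_mul_cancel₀ hrQ.ne']
    exact hI2
  set R := (Real.exp 1 + d x x₀) ^ (-(Q + 1)) with hR
  have hR0 : 0 < R := S.R_pos x
  have hR1 : R ≤ 1 := S.R_le_one x
  set τ := max (W ^ θ) R with hτ
  have hτ0 : 0 < τ := lt_of_lt_of_le hR0 (le_max_right _ _)
  have hrm : 0 < r ^ (-Q) := by positivity
  have hτb : τ ≤ 1 + C₂ + r ^ (-Q) :=
    max_le (by linarith [rpow_theta_le hW0 hθ0 hθ1]) (by linarith)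
  have hτA : τ ≤ max (m ^ θ) R := max_le_max (Real.rpow_le_rpow hW0 hWm hθ0.le) le_rfl
  set A' := max (m ^ θ) R with hA'
  have hA'0 : 0 < A' := hτ0.trans_le hτA
  have key := avg (s := pm) (P := p x) (τ := τ) (c := c) G.hgm G.hg
    (fun y => (S.R_pos y).le) G.hσm G.hσ G.hh hpm.le hpx (fun y => (S.hbounds y).1) hτ0 hA
    (fun y hy => hcc x y r _ hr (hAB hy) (le_max_right _ _) hτb)
  refine key.trans ?_
  set Sg := ∫⁻ y in A, σ y ∂μ with hSg
  have hS1 : Sg ≤ ENNReal.ofReal (r ^ Q * m) :=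
    (lintegral_mono fun y => le_max_right _ _).trans hw
  have hS2 : Sg ≤ ENNReal.ofReal (Kσ * (C₂ * r ^ Q)) := sigmaA S G hr hAB
  have hmθ : 0 ≤ m ^ θ := by positivity
  have hmax1 : 1 ≤ max 1 (Kσ * C₂) := le_max_left _ _
  have hS : Sg ≤ ENNReal.ofReal (max 1 (Kσ * C₂) * A' * r ^ Q) := by
    by_cases h1 : m ≤ 1
    · refine hS1.trans (ENNReal.ofReal_le_ofReal ?_)
      have h2 : m ≤ A' := by
        refine le_trans ?_ (le_max_left _ _)
        by_cases h0 : m = 0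
        · rw [h0]; positivity
        · have := Real.rpow_le_rpow_of_exponent_ge (lt_of_le_of_ne hm (Ne.symm h0)) h1 hθ1
          rwa [Real.rpow_one] at this
      have h3 : m ≤ max 1 (Kσ * C₂) * A' := by nlinarith
      rw [mul_comm]
      gcongr
    · refine hS2.trans (ENNReal.ofReal_le_ofReal ?_)
      have h2 : 1 ≤ A' := (Real.one_le_rpow (not_le.1 h1).le hθ0.le).trans (le_max_left _ _)
      have h3 : Kσ * C₂ ≤ max 1 (Kσ * C₂) * A' := by
        nlinarith [le_max_right 1 (Kσ * C₂)]
      calc Kσ * (C₂ * r ^ Q) = Kσ * C₂ * r ^ Q := by ring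
        _ ≤ _ := by gcongr
  refine sum3 (a' := τ * (C₂ * r ^ Q)) (e' := Real.exp c * (τ * r ^ Q)) ?_ hS ?_
    (by positivity) (by positivity) (by positivity) ?_
  · rw [ENNReal.ofReal_mul hτ0.le]
    exact mul_le_mul_right (muA S hr hAB) _
  · rw [← hI, hWI, ← ENNReal.ofReal_mul (by positivity)]
    refine ENNReal.ofReal_le_ofReal ?_
    have hWτ : W ≤ τ ^ (p x / pm) := by
      calc W = (W ^ θ) ^ (p x / pm) := by
            rw [← Real.rpow_mul hW0, hθ, div_mul_div_cancel₀ hpx0.ne', div_self (by linarith), Real.rpow_one]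
        _ ≤ _ := Real.rpow_le_rpow (by positivity) (le_max_left _ _) (by positivity)
    have h5 : τ ^ (1 - p x / pm) * τ ^ (p x / pm) = τ := by
      rw [← Real.rpow_add hτ0]; simp
    calc Real.exp c * τ ^ (1 - p x / pm) * (W * r ^ Q)
        ≤ Real.exp c * τ ^ (1 - p x / pm) * (τ ^ (p x / pm) * r ^ Q) := by gcongr
      _ = Real.exp c * ((τ ^ (1 - p x / pm) * τ ^ (p x / pm)) * r ^ Q) := by ring
      _ = _ := by rw [h5]
  · have : τ * r ^ Q ≤ A' * r ^ Q := by gcongr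
    have e := Real.exp_pos c
    nlinarith

end

end S19

namespace S19

lemma kernel {X : Type*} [MeasurableSpace X] {d : X → X → ℝ} {μ : Measure X} {g : X → ℝ}
    (hgm : Measurable g) (x : X)
    (s : ℝ) (hs : 0 < s) :
    ∃ A : ℤ → Set X, (∀ k, MeasurableSet (A k)) ∧ (∀ k : ℤ, A k ⊆ qball d x ((2:ℝ) ^ (k:ℝ))) ∧
      ∫⁻ y, ENNReal.ofReal (g y) / ENNReal.ofReal (d x y ^ s) ∂μ ≤
        ∑' k : ℤ, ENNReal.ofReal (2 ^ s * 2 ^ (-((k:ℝ) * s))) *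
          ∫⁻ y in A k, ENNReal.ofReal (g y) ∂μ := by
  obtain ⟨φ, hφm, hφle, hφeq⟩ := exists_measurable_le_lintegral_eq μ
    (fun y => ENNReal.ofReal (g y) / ENNReal.ofReal (d x y ^ s))
  set u : X → ℝ≥0∞ := fun y => φ y / ENNReal.ofReal (g y) with hu
  have hgm' : Measurable fun y => ENNReal.ofReal (g y) := hgm.ennreal_ofReal
  have hum : Measurable u := hφm.div hgm'
  have hφ0 : ∀ y, ENNReal.ofReal (g y) = 0 → φ y = 0 := by
    intro y hy
    have := hφle y
    simp only [hy, ENNReal.zero_div] at this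
    exact le_antisymm this zero_le
  have hφu : ∀ y, φ y = u y * ENNReal.ofReal (g y) := by
    intro y
    by_cases hy : ENNReal.ofReal (g y) = 0
    · rw [hφ0 y hy, hy, mul_zero]
    · rw [hu]; exact (ENNReal.div_mul_cancel hy (by simp)).symm
  have hule : ∀ y, u y ≤ (ENNReal.ofReal (d x y ^ s))⁻¹ := by
    intro y
    by_cases hy : ENNReal.ofReal (g y) = 0
    · simp [hu, hφ0 y hy]
    · rw [hu]
      refine ENNReal.div_le_of_le_mul ?_
      refine (hφle y).trans ?_
      simp only
      rw [div_eq_mul_inv, mul_comm]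
  set B : ℤ → Set X := fun k => {y | ENNReal.ofReal ((2:ℝ) ^ ((k:ℝ) * s)) < u y} with hB
  have hBm : ∀ k, MeasurableSet (B k) := fun k => measurableSet_lt measurable_const hum
  refine ⟨fun k => B (-k), fun k => hBm _, ?_, ?_⟩
  · intro k y hy
    simp only [hB, Set.mem_ofPred_eq] at hy
    have h1 := hy.trans_le (hule y)
    simp only [qball, Set.mem_ofPred_eq]
    by_contra! hcon
    refine absurd h1 (not_lt.2 ?_)
    have h2 : (2:ℝ) ^ ((k:ℝ) * s) ≤ d x y ^ s := by
      rw [Real.rpow_mul (by norm_num)]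
      exact Real.rpow_le_rpow (by positivity) hcon hs.le
    rw [ENNReal.inv_le_iff_inv_le, ← ENNReal.ofReal_inv_of_pos (by positivity)]
    refine ENNReal.ofReal_le_ofReal (le_trans (le_of_eq ?_) h2)
    rw [← Real.rpow_neg (by norm_num)]
    congr 1
    push_cast
    ring
  · rw [hφeq]
    have hre := (Equiv.neg ℤ).tsum_eq (fun k : ℤ => ENNReal.ofReal (2 ^ s * 2 ^ ((k:ℝ) * s)) *
          ∫⁻ y in B k, ENNReal.ofReal (g y) ∂μ)
    simp only [Equiv.neg_apply] at hre
    have e1 : (∑' k : ℤ, ENNReal.ofReal (2 ^ s * 2 ^ (-((k:ℝ) * s))) *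
          ∫⁻ y in B (-k), ENNReal.ofReal (g y) ∂μ) = ∑' k : ℤ, ENNReal.ofReal (2 ^ s * 2 ^ ((k:ℝ) * s)) *
          ∫⁻ y in B k, ENNReal.ofReal (g y) ∂μ := by
      rw [← hre]
      refine tsum_congr fun k => ?_
      push_cast
      rw [neg_mul]
    rw [e1]
    calc ∫⁻ y, φ y ∂μ
        ≤ ∫⁻ y, ∑' k : ℤ, ENNReal.ofReal (2 ^ s * 2 ^ ((k:ℝ) * s)) *
            (B k).indicator (fun y => ENNReal.ofReal (g y)) y ∂μ := by
          refine lintegral_mono fun y => ?_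
          simp only
          rw [hφu y]
          refine (mul_le_mul_left (dyadic_le hs (u y)) _).trans ?_
          rw [← ENNReal.tsum_mul_right]
          refine ENNReal.tsum_le_tsum fun k => ?_
          by_cases hk : ENNReal.ofReal ((2:ℝ) ^ ((k:ℝ) * s)) < u y
          · have hy : y ∈ B k := hk
            rw [if_pos hk, Set.indicator_of_mem hy, add_mul, one_mul,
              Real.rpow_add (by norm_num), mul_comm ((2:ℝ) ^ ((k:ℝ) * s))]
          · rw [if_neg hk, zero_mul]; exact zero_le
      _ = ∑' k : ℤ, ENNReal.ofReal (2 ^ s * 2 ^ ((k:ℝ) * s)) *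
          ∫⁻ y in B k, ENNReal.ofReal (g y) ∂μ := by
          rw [lintegral_tsum]
          · refine tsum_congr fun k => ?_
            rw [lintegral_const_mul' _ _ (by simp), lintegral_indicator (hBm k)]
          · intro k
            exact ((hgm'.indicator (hBm k)).const_mul _).aemeasurable

lemma hedberg {Q α pM : ℝ} (hQ : 0 < Q) (hα : 0 < α) (hβ : 0 < Q / pM - α) :
    ∃ Kg : ℝ, 0 < Kg ∧ ∀ (K1 K2 E A' P Pinf : ℝ) (a : ℤ → ℝ≥0∞), 0 < K1 → 0 < K2 → 1 ≤ E →
      0 < A' → 1 ≤ P → P ≤ pM → 1 ≤ Pinf → Pinf ≤ pM →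
      (1 < A' ^ (-(P / Q)) → (A' ^ (-(P / Q))) ^ (Q / P - Q / Pinf) ≤ E) →
      (∀ k : ℤ, a k ≤ ENNReal.ofReal (K2 * A' * ((2:ℝ) ^ (k:ℝ)) ^ Q)) →
      (∀ k : ℤ, (2:ℝ) ^ (k:ℝ) ≤ 1 → a k ≤
        ENNReal.ofReal (K1 * ((2:ℝ) ^ (k:ℝ)) ^ Q * ((2:ℝ) ^ (k:ℝ)) ^ (-(Q / P)))) →
      (∀ k : ℤ, 1 ≤ (2:ℝ) ^ (k:ℝ) → a k ≤
        ENNReal.ofReal (K1 * ((2:ℝ) ^ (k:ℝ)) ^ Q * ((2:ℝ) ^ (k:ℝ)) ^ (-(Q / Pinf)))) →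
      ∑' k : ℤ, ENNReal.ofReal (2 ^ (Q - α) * 2 ^ (-((k:ℝ) * (Q - α)))) * a k ≤
        ENNReal.ofReal (Kg * (K2 + K1 + K1 * E) * A' ^ (1 - α * P / Q)) := by
  obtain ⟨Ka, hKa, hga⟩ := geo_sum hα
  obtain ⟨Kb, hKb, hgb⟩ := geo_tail hβ
  refine ⟨2 ^ (Q - α) * (Ka + Kb), by positivity, ?_⟩
  intro K1 K2 E A' P Pinf a hK1 hK2 hE hA' hP1 hPM hPi1 hPiM hEδ ha1 ha2 ha3
  have hP0 : 0 < P := by linarith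
  have hPi0 : 0 < Pinf := by linarith
  have hβP : Q / pM - α ≤ Q / P - α := by gcongr
  have hβI : Q / pM - α ≤ Q / Pinf - α := by gcongr
  set δ := A' ^ (-(P / Q)) with hδ
  have hδ0 : 0 < δ := by positivity
  have hδm : 0 < max δ 1 := by positivity
  set Z := A' ^ (1 - α * P / Q) with hZ
  have hZ0 : 0 < Z := by positivity
  have e1 : A' * δ ^ α = Z := by
    rw [hδ, hZ, ← Real.rpow_mul hA'.le]
    nth_rewrite 1 [← Real.rpow_one A']
    rw [← Real.rpow_add hA']
    congr 1; ring
  have e2 : δ ^ (-(Q / P - α)) = Z := by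
    rw [hδ, hZ, ← Real.rpow_mul hA'.le]
    congr 1
    field_simp
  have e3 : (max δ 1) ^ (-(Q / Pinf - α)) ≤ E * Z := by
    by_cases h1 : 1 < δ
    · rw [max_eq_left h1.le]
      calc δ ^ (-(Q / Pinf - α)) = δ ^ (Q / P - Q / Pinf) * δ ^ (-(Q / P - α)) := by
            rw [← Real.rpow_add hδ0]; congr 1; ring
        _ ≤ E * Z := by rw [e2]; exact mul_le_mul_of_nonneg_right (hEδ h1) hZ0.le
    · have h1' : δ ≤ 1 := not_lt.1 h1
      rw [max_eq_right h1', Real.one_rpow]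
      have : 1 ≤ Z := by
        rw [← e2]
        exact Real.one_le_rpow_of_pos_of_le_one_of_nonpos hδ0 h1' (by linarith)
      nlinarith
  set T1 : ℤ → ℝ≥0∞ := fun k => if (2:ℝ) ^ (k:ℝ) ≤ δ then ENNReal.ofReal (2 ^ ((k:ℝ) * α)) else 0 with hT1
  set T2 : ℤ → ℝ≥0∞ := fun k => if δ ≤ (2:ℝ) ^ (k:ℝ) then
    ENNReal.ofReal (2 ^ (-((k:ℝ) * (Q / P - α)))) else 0 with hT2
  set T3 : ℤ → ℝ≥0∞ := fun k => if max δ 1 ≤ (2:ℝ) ^ (k:ℝ) then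
    ENNReal.ofReal (2 ^ (-((k:ℝ) * (Q / Pinf - α)))) else 0 with hT3
  have s1 : ∑' k, T1 k ≤ ENNReal.ofReal (Ka * δ ^ α) := hga α le_rfl δ hδ0
  have s2 : ∑' k, T2 k ≤ ENNReal.ofReal (Kb * δ ^ (-(Q / P - α))) := hgb _ hβP δ hδ0
  have s3 : ∑' k, T3 k ≤ ENNReal.ofReal (Kb * (max δ 1) ^ (-(Q / Pinf - α))) := hgb _ hβI _ hδm
  set D := (2:ℝ) ^ (Q - α) with hD
  have hD0 : 0 < D := by positivity
  have hb : ∀ (k : ℤ) (γ : ℝ), (2:ℝ) ^ (-((k:ℝ) * (Q - α))) * (((2:ℝ) ^ (k:ℝ)) ^ Q * ((2:ℝ) ^ (k:ℝ)) ^ (-γ))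
      = 2 ^ (-((k:ℝ) * (γ - α))) := by
    intro k γ
    rw [← Real.rpow_mul (by norm_num), ← Real.rpow_mul (by norm_num), ← Real.rpow_add (by norm_num),
      ← Real.rpow_add (by norm_num)]
    congr 1; ring
  have hb0 : ∀ (k : ℤ), (2:ℝ) ^ (-((k:ℝ) * (Q - α))) * (((2:ℝ) ^ (k:ℝ)) ^ Q)
      = 2 ^ ((k:ℝ) * α) := by
    intro k
    rw [← Real.rpow_mul (by norm_num), ← Real.rpow_add (by norm_num)]
    congr 1; ring
  have hterm : ∀ k : ℤ, ENNReal.ofReal (D * 2 ^ (-((k:ℝ) * (Q - α)))) * a k ≤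
      ENNReal.ofReal (D * (K2 * A')) * T1 k + ENNReal.ofReal (D * K1) * T2 k +
        ENNReal.ofReal (D * K1) * T3 k := by
    intro k
    by_cases h1 : (2:ℝ) ^ (k:ℝ) ≤ δ
    · refine le_trans ?_ (le_self_add.trans le_self_add)
      refine (mul_le_mul_right (ha1 k) _).trans ?_
      simp only [hT1, if_pos h1]
      rw [← ENNReal.ofReal_mul (by positivity), ← ENNReal.ofReal_mul (by positivity), ← hb0 k]
      refine ENNReal.ofReal_le_ofReal (le_of_eq (by ring))
    · have h1' : δ ≤ (2:ℝ) ^ (k:ℝ) := (not_le.1 h1).le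
      by_cases h2 : (2:ℝ) ^ (k:ℝ) ≤ 1
      · refine le_trans ?_ (le_add_self.trans le_self_add)
        refine (mul_le_mul_right (ha2 k h2) _).trans ?_
        simp only [hT2, if_pos h1']
        rw [← ENNReal.ofReal_mul (by positivity), ← ENNReal.ofReal_mul (by positivity), ← hb k (Q / P)]
        refine ENNReal.ofReal_le_ofReal (le_of_eq (by ring))
      · have h2' : 1 ≤ (2:ℝ) ^ (k:ℝ) := (not_le.1 h2).le
        refine le_trans ?_ le_add_self
        refine (mul_le_mul_right (ha3 k h2') _).trans ?_
        simp only [hT3, if_pos (max_le h1' h2')]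
        rw [← ENNReal.ofReal_mul (by positivity), ← ENNReal.ofReal_mul (by positivity), ← hb k (Q / Pinf)]
        refine ENNReal.ofReal_le_ofReal (le_of_eq (by ring))
  refine (ENNReal.tsum_le_tsum hterm).trans ?_
  rw [ENNReal.tsum_add, ENNReal.tsum_add, ENNReal.tsum_mul_left, ENNReal.tsum_mul_left,
    ENNReal.tsum_mul_left]
  refine sum3 (a' := D * (K2 * A') * (Ka * δ ^ α)) (b' := D * K1 * (Kb * δ ^ (-(Q / P - α))))
    (e' := D * K1 * (Kb * (max δ 1) ^ (-(Q / Pinf - α)))) ?_ ?_ ?_ (by positivity) (by positivity)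
    (by positivity) ?_
  · rw [ENNReal.ofReal_mul (p := D * (K2 * A')) (by positivity)]; exact mul_le_mul_right s1 _
  · rw [ENNReal.ofReal_mul (p := D * K1) (by positivity)]; exact mul_le_mul_right s2 _
  · rw [ENNReal.ofReal_mul (p := D * K1) (by positivity)]; exact mul_le_mul_right s3 _
  · rw [e2]
    have f1 : D * (K2 * A') * (Ka * δ ^ α) = D * K2 * Ka * Z := by rw [← e1]; ring
    rw [f1]
    have f3 : D * K1 * (Kb * (max δ 1) ^ (-(Q / Pinf - α))) ≤ D * K1 * (Kb * (E * Z)) := by gcongr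
    have hE0 : 0 < E := by linarith
    have n1 : 0 ≤ D * K2 * Kb * Z := by positivity
    have n2 : 0 ≤ D * K1 * Ka * Z := by positivity
    have n3 : 0 ≤ D * K1 * Ka * Z * E := by positivity
    nlinarith

end S19

namespace S19

section
variable {X : Type*} [MeasurableSpace X] {d : X → X → ℝ} {μ : Measure X}
    {A₀ C₂ Q : ℝ} {p : X → ℝ} {C₀ : ℝ} {x₀ : X} {Cinf pinf pm pM : ℝ}

lemma Econd (S : Setup d μ A₀ C₂ Q p C₀ x₀ Cinf pinf pm pM) (x : X) {A' : ℝ}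
    (hA : (Real.exp 1 + d x x₀) ^ (-(Q + 1)) ≤ A') (hδ1 : 1 < A' ^ (-(p x / Q))) :
    (A' ^ (-(p x / Q))) ^ (Q / p x - Q / pinf) ≤ Real.exp ((Q + 1) * pM * Cinf) := by
  have hQ := S.hQ
  have hpm := S.hpm1
  have hb := S.hbounds x
  have hpi := S.pinf_bounds
  have hp0 : 0 < p x := by linarith
  have hi0 : 0 < pinf := by linarith
  have hA0 : 0 < A' := (S.R_pos x).trans_le hA
  have hlA := Real.log_le_log (S.R_pos x) hA
  rw [Real.log_rpow (S.rho_pos x)] at hlA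
  have hL := S.log_rho x
  have hI := S.inf_log x
  set L := Real.log (Real.exp 1 + d x x₀) with hLdef
  have hδ0 : 0 < A' ^ (-(p x / Q)) := by positivity
  rw [Real.rpow_def_of_pos hδ0]
  refine Real.exp_le_exp.2 ?_
  have hlδ : 0 < Real.log (A' ^ (-(p x / Q))) := Real.log_pos hδ1
  have hlδ2 : Real.log (A' ^ (-(p x / Q))) ≤ p x / Q * ((Q + 1) * L) := by
    rw [Real.log_rpow hA0]
    have : p x / Q * (-Real.log A') ≤ p x / Q * ((Q + 1) * L) := by
      refine mul_le_mul_of_nonneg_left ?_ (by positivity)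
      linarith
    linarith
  have hdiff : Q / p x - Q / pinf ≤ Q / p x * |p x - pinf| := by
    have e : Q / p x - Q / pinf = Q / p x * ((pinf - p x) / pinf) := by
      field_simp
    rw [e]
    refine mul_le_mul_of_nonneg_left ?_ (by positivity)
    rw [div_le_iff₀ hi0]
    have := neg_abs_le (p x - pinf)
    nlinarith [abs_nonneg (p x - pinf)]
  have hab : 0 ≤ Q / p x * |p x - pinf| := by positivity
  calc Real.log (A' ^ (-(p x / Q))) * (Q / p x - Q / pinf)
      ≤ Real.log (A' ^ (-(p x / Q))) * (Q / p x * |p x - pinf|) := by gcongr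
    _ ≤ (p x / Q * ((Q + 1) * L)) * (Q / p x * |p x - pinf|) := by gcongr
    _ = (Q + 1) * (|p x - pinf| * L) := by field_simp
    _ ≤ (Q + 1) * Cinf := by gcongr
    _ ≤ (Q + 1) * pM * Cinf := by
        have := S.Cinf_nonneg
        have h1 : 1 ≤ pM := by linarith
        have : (Q + 1) * 1 ≤ (Q + 1) * pM := by gcongr
        nlinarith

lemma pointwise (S : Setup d μ A₀ C₂ Q p C₀ x₀ Cinf pinf pm pM) {α c Kσ : ℝ} (hα : 0 < α)
    (hαQ : α < Q) (hβ : 0 < Q / pM - α) (hcc : CondC d Q C₂ p x₀ c) (hK1 : 1 ≤ Kσ) :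
    ∃ K : ℝ, 0 < K ∧ ∀ (g : X → ℝ) (h σ : X → ℝ≥0∞), GData d μ Q p x₀ g h σ Kσ →
      ∀ (x : X) (m : ℝ), 0 ≤ m →
      mAux d μ Q (fun y => max (h y ^ (1 / pm)) (σ y)) x ≤ ENNReal.ofReal m →
      ∫⁻ y, ENNReal.ofReal (g y) / ENNReal.ofReal (d x y ^ (Q - α)) ∂μ ≤
        ENNReal.ofReal (K * (max (m ^ (pm / p x)) ((Real.exp 1 + d x x₀) ^ (-(Q + 1)))) ^
          (1 - α * p x / Q)) := by
  have hQ := S.hQ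
  have hC₂ := S.hC₂
  have hpm := S.hpm1
  have hpi := S.pinf_bounds
  have hCi := S.Cinf_nonneg
  have hKσ : 0 < Kσ := by linarith
  obtain ⟨Kg, hKg, hH⟩ := hedberg hQ hα hβ
  set K1 := (C₂ + Kσ * C₂ + Real.exp c) + (C₂ + Kσ + Real.exp ((Q + 1) * Cinf)) with hK1def
  set K2 := C₂ + max 1 (Kσ * C₂) + Real.exp c with hK2def
  have hK10 : 0 < K1 := by positivity
  have hK20 : 0 < K2 := by positivity
  refine ⟨Kg * (K2 + K1 + K1 * Real.exp ((Q + 1) * pM * Cinf)), by positivity, ?_⟩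
  intro g h σ G x m hm hM
  have hb := S.hbounds x
  have hpM0 : 0 < pM := by linarith
  obtain ⟨A, hAm, hAB, hle⟩ := kernel (d := d) (μ := μ) G.hgm x (Q - α) (by linarith)
  refine hle.trans ?_
  refine hH K1 K2 _ _ (p x) pinf _ hK10 hK20 (Real.one_le_exp (by positivity))
    (lt_of_lt_of_le (S.R_pos x) (le_max_right _ _)) (by linarith) hb.2 (by linarith) hpi.2
    (Econd S x (le_max_right _ _)) ?_ ?_ ?_
  · intro k
    exact L2 S G hcc hm hM (by positivity) (hAm k) (hAB k)
  · intro k hk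
    refine (L1a S G hcc (by positivity) hk (hAm k) (hAB k)).trans (ENNReal.ofReal_le_ofReal ?_)
    have : C₂ + Kσ * C₂ + Real.exp c ≤ K1 := by
      rw [hK1def]; linarith [Real.exp_pos ((Q + 1) * Cinf)]
    gcongr
  · intro k hk
    refine (L1b S G hk (hAm k) (hAB k)).trans (ENNReal.ofReal_le_ofReal ?_)
    have : C₂ + Kσ + Real.exp ((Q + 1) * Cinf) ≤ K1 := by
      rw [hK1def]
      have : 0 < Kσ * C₂ := by positivity
      linarith [Real.exp_pos c]
    gcongr

lemma qpow (S : Setup d μ A₀ C₂ Q p C₀ x₀ Cinf pinf pm pM) {α c Kσ : ℝ} {q : X → ℝ} (hα : 0 < α)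
    (hαQ : α < Q) (hβ : 0 < Q / pM - α) (hcc : CondC d Q C₂ p x₀ c) (hK1 : 1 ≤ Kσ)
    (hq : ∀ x, 1 / q x = 1 / p x - α / Q) :
    ∃ K : ℝ, 0 < K ∧ ∀ (g : X → ℝ) (h σ : X → ℝ≥0∞), GData d μ Q p x₀ g h σ Kσ →
      ∀ (x : X) (t : ℝ≥0∞), (mAux d μ Q (fun y => max (h y ^ (1 / pm)) (σ y)) x) ^ pm ≤ t →
      (∫⁻ y, ENNReal.ofReal (g y) / ENNReal.ofReal (d x y ^ (Q - α)) ∂μ) ^ (q x) ≤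
        ENNReal.ofReal K * (t + σ x) := by
  have hQ := S.hQ
  have hpm := S.hpm1
  have hpmM : pm ≤ pM := (S.hbounds x₀).1.trans (S.hbounds x₀).2
  have hpM0 : 0 < pM := by linarith
  obtain ⟨K, hK, hP⟩ := pointwise S hα hαQ hβ hcc hK1
  have hβ' : 0 < 1 / pM - α / Q := by
    have : 1 / pM - α / Q = (Q / pM - α) / Q := by field_simp
    rw [this]; positivity
  refine ⟨(max K 1) ^ (1 / (1 / pM - α / Q)), by positivity, ?_⟩
  intro g h σ G x t ht
  have hb := S.hbounds x
  have hp0 : 0 < p x := by linarith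
  have hqi : 1 / pM - α / Q ≤ 1 / q x := by
    rw [hq x]
    have : 1 / pM ≤ 1 / p x := one_div_le_one_div_of_le hp0 hb.2
    linarith
  have hq0 : 0 < q x := by
    have : 0 < 1 / q x := by linarith
    exact one_div_pos.1 this
  have hqM : q x ≤ 1 / (1 / pM - α / Q) := by
    rw [le_div_iff₀ hβ']
    rw [le_div_iff₀ hq0] at hqi
    linarith
  have hexp : (1 - α * p x / Q) * q x = p x := by
    have h1 := hq x
    field_simp at h1 ⊢
    linarith
  set M := mAux d μ Q (fun y => max (h y ^ (1 / pm)) (σ y)) x with hM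
  set K' := (max K 1) ^ (1 / (1 / pM - α / Q)) with hK'
  have hK'0 : 0 < K' := by positivity
  by_cases hMt : M = ⊤
  · rw [hMt, ENNReal.top_rpow_of_pos (by linarith)] at ht
    rw [top_le_iff.1 ht, top_add, ENNReal.mul_top (by simpa using hK'0)]
    exact le_top
  set m := M.toReal with hm
  have hm0 : 0 ≤ m := ENNReal.toReal_nonneg
  have hMm : M = ENNReal.ofReal m := (ENNReal.ofReal_toReal hMt).symm
  set R := (Real.exp 1 + d x x₀) ^ (-(Q + 1)) with hR
  have hR0 : 0 < R := S.R_pos x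
  have hR1 : R ≤ 1 := S.R_le_one x
  have h1 := hP g h σ G x m hm0 hMm.le
  set A' := max (m ^ (pm / p x)) R with hA'
  have hA'0 : 0 < A' := lt_of_lt_of_le hR0 (le_max_right _ _)
  have h2 : A' ^ p x ≤ m ^ pm + R := by
    rcases max_choice (m ^ (pm / p x)) R with h | h
    · rw [hA', h, ← Real.rpow_mul hm0, div_mul_cancel₀ _ hp0.ne']
      linarith
    · rw [hA', h]
      have h3 : R ^ p x ≤ R ^ (1:ℝ) := Real.rpow_le_rpow_of_exponent_ge hR0 hR1 (by linarith)
      rw [Real.rpow_one] at h3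
      have : 0 ≤ m ^ pm := by positivity
      linarith
  calc (∫⁻ y, ENNReal.ofReal (g y) / ENNReal.ofReal (d x y ^ (Q - α)) ∂μ) ^ (q x)
      ≤ (ENNReal.ofReal (K * A' ^ (1 - α * p x / Q))) ^ q x := ENNReal.rpow_le_rpow h1 hq0.le
    _ = ENNReal.ofReal (K ^ q x * A' ^ p x) := by
        rw [ENNReal.ofReal_rpow_of_nonneg (by positivity) hq0.le,
          Real.mul_rpow hK.le (by positivity), ← Real.rpow_mul hA'0.le, hexp]
    _ ≤ ENNReal.ofReal (K' * (m ^ pm + R)) := by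
        refine ENNReal.ofReal_le_ofReal ?_
        have h4 : K ^ q x ≤ K' := by
          calc K ^ q x ≤ (max K 1) ^ q x := Real.rpow_le_rpow hK.le (le_max_left _ _) hq0.le
            _ ≤ K' := Real.rpow_le_rpow_of_exponent_le (le_max_right _ _) hqM
        gcongr
    _ = ENNReal.ofReal K' * (M ^ pm + ENNReal.ofReal R) := by
        rw [ENNReal.ofReal_mul hK'0.le, ENNReal.ofReal_add (by positivity) hR0.le, hMm,
          ENNReal.ofReal_rpow_of_nonneg hm0 (by linarith)]
    _ ≤ ENNReal.ofReal K' * (t + σ x) := mul_le_mul_right (add_le_add ht (G.hσ x)) _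

lemma modular_bound (S : Setup d μ A₀ C₂ Q p C₀ x₀ Cinf pinf pm pM) {α : ℝ} {q : X → ℝ} (hα : 0 < α)
    (hαQ : α < Q) (hβ : 0 < Q / pM - α)
    (hq : ∀ x, 1 / q x = 1 / p x - α / Q) :
    ∃ K : ℝ, 0 < K ∧ ∀ (g : X → ℝ), Measurable g → (∀ y, 0 ≤ g y) →
      ∫⁻ y, ENNReal.ofReal (g y ^ p y) ∂μ ≤ 1 →
      ∫⁻ x, (∫⁻ y, ENNReal.ofReal (g y) / ENNReal.ofReal (d x y ^ (Q - α)) ∂μ) ^ (q x) ∂μ ≤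
        ENNReal.ofReal K := by
  have hpm := S.hpm1
  obtain ⟨c, hcc⟩ := S.cond
  obtain ⟨σ, Kσ, hσm, hKσ, hσ, hσK, hσI⟩ := sigma_exists S.hqm S.hC₂ S.hQ S.hup x₀
  obtain ⟨K, hK, hqp⟩ := qpow S hα hαQ hβ hcc hKσ hq
  obtain ⟨Ks, hKs, hst⟩ := strong_type S.hqm S.hC₂ S.hQ S.hup hpm
  have hKσ0 : 0 < Kσ := by linarith
  refine ⟨K * (Ks * (1 + Kσ ^ (pm - 1) * Kσ) + Kσ), by positivity, ?_⟩
  intro g hgm hg hg1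
  obtain ⟨h, hhm, hh1, hh⟩ := minorant _ hg1
  have G : GData d μ Q p x₀ g h σ Kσ := ⟨hgm, hg, hhm, hh1, hh, hσm, hKσ, hσ, hσK, hσI⟩
  obtain ⟨Φ, hΦm, hΦ, hΦI⟩ := hst (fun y => max (h y ^ (1 / pm)) (σ y))
    ((hhm.pow_const _).max hσm)
  have hw : ∫⁻ y, (max (h y ^ (1 / pm)) (σ y)) ^ pm ∂μ ≤ ENNReal.ofReal (1 + Kσ ^ (pm - 1) * Kσ) := by
    calc ∫⁻ y, (max (h y ^ (1 / pm)) (σ y)) ^ pm ∂μ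
        ≤ ∫⁻ y, (h y + ENNReal.ofReal (Kσ ^ (pm - 1)) * σ y) ∂μ := by
          refine lintegral_mono fun y => ?_
          simp only
          rcases max_choice (h y ^ (1 / pm)) (σ y) with e | e
          · rw [e, ← ENNReal.rpow_mul, one_div_mul_cancel (by linarith), ENNReal.rpow_one]
            exact le_self_add
          · rw [e]
            refine le_trans ?_ le_add_self
            calc σ y ^ pm = σ y ^ (pm - 1) * σ y ^ (1:ℝ) := by
                  rw [← ENNReal.rpow_add_of_nonneg _ _ (by linarith) (by norm_num)]
                  congr 1; ring
              _ ≤ ENNReal.ofReal (Kσ ^ (pm - 1)) * σ y := by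
                  rw [ENNReal.rpow_one, ← ENNReal.ofReal_rpow_of_pos hKσ0]
                  exact mul_le_mul_left (ENNReal.rpow_le_rpow (hσK y) (by linarith)) _
      _ = ∫⁻ y, h y ∂μ + ENNReal.ofReal (Kσ ^ (pm - 1)) * ∫⁻ y, σ y ∂μ := by
          rw [lintegral_add_left hhm, lintegral_const_mul' _ _ (by simp)]
      _ ≤ 1 + ENNReal.ofReal (Kσ ^ (pm - 1)) * ENNReal.ofReal Kσ :=
          add_le_add hh1 (mul_le_mul_right hσI _)
      _ = _ := by
          rw [ENNReal.ofReal_add (by norm_num) (by positivity), ENNReal.ofReal_one,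
            ENNReal.ofReal_mul (by positivity)]
  calc ∫⁻ x, (∫⁻ y, ENNReal.ofReal (g y) / ENNReal.ofReal (d x y ^ (Q - α)) ∂μ) ^ (q x) ∂μ
      ≤ ∫⁻ x, ENNReal.ofReal K * (Φ x + σ x) ∂μ :=
        lintegral_mono fun x => hqp g h σ G x (Φ x) (hΦ x)
    _ = ENNReal.ofReal K * (∫⁻ x, Φ x ∂μ + ∫⁻ x, σ x ∂μ) := by
        rw [lintegral_const_mul' _ _ (by simp), lintegral_add_left hΦm]
    _ ≤ ENNReal.ofReal K * (ENNReal.ofReal Ks * ENNReal.ofReal (1 + Kσ ^ (pm - 1) * Kσ) +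
          ENNReal.ofReal Kσ) :=
        mul_le_mul_right (add_le_add (hΦI.trans (mul_le_mul_right hw _)) hσI) _
    _ = _ := by
        rw [← ENNReal.ofReal_mul hKs.le, ← ENNReal.ofReal_add (by positivity) hKσ0.le,
          ← ENNReal.ofReal_mul hK.le]

end

end S19

namespace S19

lemma vModular_ofReal {X : Type*} [MeasurableSpace X] (μ : Measure X) (p : X → ℝ)
    (hp : ∀ x, 0 ≤ p x) (g : X → ℝ≥0∞) (lam : ℝ≥0∞) :
    vModular μ (fun x => ENNReal.ofReal (p x)) g lam = ∫⁻ x, (g x / lam) ^ p x ∂μ := by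
  unfold vModular
  have h1 : {x | ENNReal.ofReal (p x) ≠ ⊤} = Set.univ := by ext x; simp
  have h2 : {x | ENNReal.ofReal (p x) = ⊤} = ∅ := by ext x; simp
  rw [h1, h2, Measure.restrict_univ, Measure.restrict_empty, essSup_measure_zero]
  simp only [bot_eq_zero, mul_zero, add_zero]
  refine lintegral_congr fun x => ?_
  rw [ENNReal.toReal_ofReal (hp x)]

end S19

/-- Strong-type bound for `I*_α` on an Ahlfors regular space of dimension `Q`. -/
theorem stmt19 {X : Type*} [MeasurableSpace X] (d : X → X → ℝ) (μ : MeasureTheory.Measure X)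
    (A₀ : ℝ) (hqm : IsQuasiMetric d A₀)
    (C₁ C₂ Qdim : ℝ) (hC₁ : 0 < C₁) (hC₂ : 0 < C₂) (hQ : 0 < Qdim)
    (hAhlfors : ∀ (x : X) (r : ℝ), 0 < r →
      ENNReal.ofReal (C₁ * r ^ Qdim) ≤ μ (qball d x r) ∧
      μ (qball d x r) ≤ ENNReal.ofReal (C₂ * r ^ Qdim))
    (hinf : μ Set.univ = ⊤)
    (α : ℝ) (hα0 : 0 < α) (hαQ : α < Qdim)
    (p q : X → ℝ) (hp1 : ∀ x, 1 ≤ p x)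
    (C₀ : ℝ) (hLH0 : LH0 d p C₀)
    (x₀ : X) (Cinf pinf : ℝ) (hLHinf : LHinf d p x₀ Cinf pinf)
    (pm pM : ℝ) (hpm1 : 1 < pm) (hpmM : pm ≤ pM) (hpM : pM < Qdim / α)
    (hbounds : ∀ x, pm ≤ p x ∧ p x ≤ pM)
    (hq : ∀ x, 1 / q x = 1 / p x - α / Qdim) :
    ∃ C : ℝ, 0 < C ∧ ∀ f : X → ℝ, Measurable f →
      vNorm μ (fun x => ENNReal.ofReal (p x)) (fun x => ENNReal.ofReal |f x|) < ⊤ →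
      vNorm μ (fun x => ENNReal.ofReal (q x)) (fracIntStar d μ Qdim α f) ≤
        ENNReal.ofReal C * vNorm μ (fun x => ENNReal.ofReal (p x)) (fun x => ENNReal.ofReal |f x|) := by
  have hpM1 : 1 < pM := by linarith
  have hpM0 : 0 < pM := by linarith
  have hβ : 0 < Qdim / pM - α := by
    rw [lt_div_iff₀ hα0] at hpM
    rw [sub_pos, lt_div_iff₀ hpM0]
    linarith
  have S : S19.Setup d μ A₀ C₂ Qdim p C₀ x₀ Cinf pinf pm pM :=
    ⟨hqm, hC₂, hQ, fun x r hr => (hAhlfors x r hr).2, hinf, hLH0, hLHinf, hpm1, hbounds⟩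
  obtain ⟨K, hK, hmod⟩ := S19.modular_bound S hα0 hαQ hβ hq
  have hq1 : ∀ x, 1 ≤ q x := by
    intro x
    have hb := hbounds x
    have hp0 : 0 < p x := by linarith
    have h1 : 1 / pM - α / Qdim = (Qdim / pM - α) / Qdim := by field_simp
    have h2 : 0 < 1 / pM - α / Qdim := by rw [h1]; positivity
    have h3 : 1 / pM ≤ 1 / p x := one_div_le_one_div_of_le hp0 hb.2
    have h4 : 0 < 1 / q x := by rw [hq x]; linarith
    have h5 : 1 / q x ≤ 1 := by
      rw [hq x]
      have : 1 / p x ≤ 1 := by rw [div_le_one hp0]; exact hp1 x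
      have : 0 < α / Qdim := by positivity
      linarith
    have h6 : 0 < q x := one_div_pos.1 h4
    rwa [div_le_one h6] at h5
  set C := max K 1 with hC
  have hC1 : 1 ≤ C := le_max_right _ _
  have hC0 : 0 < C := by linarith
  have hCe : ENNReal.ofReal C ≠ 0 := by simpa using hC0
  refine ⟨C, hC0, fun f hf _ => ?_⟩
  rw [← ENNReal.div_le_iff' hCe ENNReal.ofReal_ne_top]
  refine le_sInf ?_
  rintro lam ⟨hlam0, hlam⟩
  by_cases hlt : lam = ⊤
  · rw [hlt]; exact le_top
  rw [ENNReal.div_le_iff' hCe ENNReal.ofReal_ne_top]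
  refine sInf_le ⟨ENNReal.mul_pos hCe hlam0.ne', ?_⟩
  rw [S19.vModular_ofReal μ p (fun x => by linarith [hp1 x])] at hlam
  rw [S19.vModular_ofReal μ q (fun x => by linarith [hq1 x])]
  have hl0 : 0 < lam.toReal := ENNReal.toReal_pos hlam0.ne' hlt
  have hlr : ENNReal.ofReal lam.toReal = lam := ENNReal.ofReal_toReal hlt
  have hge : ∀ y, ENNReal.ofReal (|f y| / lam.toReal) = ENNReal.ofReal |f y| / lam := by
    intro y
    rw [ENNReal.ofReal_div_of_pos hl0, hlr]
  have key := hmod (fun y => |f y| / lam.toReal)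
    ((continuous_abs.measurable.comp hf).div_const _) (fun y => by positivity) (by
      refine le_trans (le_of_eq ?_) hlam
      refine lintegral_congr fun y => ?_
      rw [← hge y, ENNReal.ofReal_rpow_of_nonneg (by positivity) (by linarith [hp1 y])])
  have hI : ∀ x, ∫⁻ y, ENNReal.ofReal (|f y| / lam.toReal) / ENNReal.ofReal (d x y ^ (Qdim - α)) ∂μ
      = fracIntStar d μ Qdim α f x / lam := by
    intro x
    unfold fracIntStar
    rw [div_eq_mul_inv _ lam, ← lintegral_mul_const' _ _ (by simpa using hlam0.ne')]
    refine lintegral_congr fun y => ?_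
    rw [hge y, div_eq_mul_inv, div_eq_mul_inv, div_eq_mul_inv, mul_right_comm]
  simp only [hI] at key
  calc ∫⁻ x, (fracIntStar d μ Qdim α f x / (ENNReal.ofReal C * lam)) ^ q x ∂μ
      ≤ ∫⁻ x, (ENNReal.ofReal C)⁻¹ * (fracIntStar d μ Qdim α f x / lam) ^ q x ∂μ := by
        refine lintegral_mono fun x => ?_
        simp only
        have e : fracIntStar d μ Qdim α f x / (ENNReal.ofReal C * lam) =
            (ENNReal.ofReal C)⁻¹ * (fracIntStar d μ Qdim α f x / lam) := by
          rw [div_eq_mul_inv, ENNReal.mul_inv (Or.inl hCe) (Or.inl ENNReal.ofReal_ne_top),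
            div_eq_mul_inv, mul_left_comm]
        rw [e, ENNReal.mul_rpow_of_nonneg _ _ (by linarith [hq1 x])]
        refine mul_le_mul_left ?_ _
        have h1 : (ENNReal.ofReal C)⁻¹ ≤ 1 := by
          rw [ENNReal.inv_le_one, ENNReal.one_le_ofReal]; exact hC1
        have := ENNReal.rpow_le_rpow_of_exponent_ge h1 (hq1 x)
        rwa [ENNReal.rpow_one] at this
    _ = (ENNReal.ofReal C)⁻¹ * ∫⁻ x, (fracIntStar d μ Qdim α f x / lam) ^ q x ∂μ :=
        lintegral_const_mul' _ _ (by simpa using hC0)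
    _ ≤ (ENNReal.ofReal C)⁻¹ * ENNReal.ofReal C :=
        mul_le_mul_right (key.trans (ENNReal.ofReal_le_ofReal (le_max_left _ _))) _
    _ = 1 := ENNReal.inv_mul_cancel hCe ENNReal.ofReal_ne_top
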